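/- arXiv:2504.00669 — 5 statements merged into one kernel-verified Lean document; each statement's English description precedes it below -/
import Mathlib

section
/- Let p be an odd prime and G a group of order p^5 with Z(G) = G' elementary abelian of order p². Then for every nonlinear irreducible complex character χ of G the subgroup K_χ = ker χ ∩ Z(G) has order p and χ is the lift (inflation) of a nonlinear irreducible complex character of G/K_χ. Moreover, inflation gives a bijection between the set of pairs (K, χ̄), where K is a subgroup of Z(G) of order p and χ̄ is a nonlinear irreducible complex character of G/K, and the set of nonlinear irreducible complex characters of G; in particular G has exactly p³ − p nonlinear irreducible complex characters (up to equality of characters). -/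
/-- An irreducible complex character of a group `G`: the trace character of some
irreducible (simple) finite-dimensional complex representation of `G`. -/
def IsIrredCharacter {G : Type} [Monoid G] (χ : G → ℂ) : Prop :=
  ∃ V : FDRep ℂ G, CategoryTheory.Simple V ∧ V.character = χ

namespace Stmt5

open Representation commutatorElement

lemma finrank_ne {G : Type} [Group G] [Fintype G] (V : FDRep ℂ G)
    (hV : CategoryTheory.Simple V) : Module.finrank ℂ V ≠ 0 := by
  have h1 := (FDRep.simple_iff_char_is_norm_one V).1 hV
  intro h0
  have hsub : Subsingleton V := (Module.finrank_zero_iff (R := ℂ)).1 h0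
  have : ∀ g, V.character g = 0 := by
    intro g
    have : V.ρ g = 0 := by ext x; exact Subsingleton.elim _ _
    simp [FDRep.character, this]
  simp only [this] at h1
  rw [Finset.sum_eq_zero (by simp)] at h1
  exact (Nat.cast_ne_zero.2 Nat.card_pos.ne') h1.symm

/-- Schur's lemma for simple objects of `FDRep`. -/
lemma schur {G : Type} [Group G] [Fintype G] (V : FDRep ℂ G) (hV : CategoryTheory.Simple V)
    (T : V →ₗ[ℂ] V) (hT : ∀ g, T ∘ₗ V.ρ g = V.ρ g ∘ₗ T) : ∃ c : ℂ, T = c • 1 := by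
  have h1 := (FDRep.simple_iff_char_is_norm_one V).1 hV
  have hne : (Nat.card G : ℂ) ≠ 0 := by simp
  let _ : Invertible (Nat.card G : ℂ) := invertibleOfNonzero hne
  have h2 := card_inv_mul_sum_char_mul_char_eq_finrank (k := ℂ) (G := G) V.ρ V.ρ
  have h3 : ∀ g, Representation.character V.ρ g = V.character g := fun g => rfl
  simp_rw [h3] at h2
  rw [h1, inv_mul_cancel₀ hne] at h2
  have h4 : Module.finrank ℂ (IntertwiningMap V.ρ V.ρ) = 1 := by exact_mod_cast h2.symm
  have hfin : Module.finrank ℂ V ≠ 0 := finrank_ne V hV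
  have hid : (IntertwiningMap.id V.ρ) ≠ 0 := by
    intro h0
    apply hfin
    have hsub : Subsingleton V := by
      refine ⟨fun a b => ?_⟩
      have ha := congrArg (fun f => f a) h0
      have hb := congrArg (fun f => f b) h0
      simp at ha hb
      rw [ha, hb]
    exact Module.finrank_zero_of_subsingleton
  obtain ⟨c, hc⟩ := (finrank_eq_one_iff_of_nonzero' _ hid).1 h4
    ⟨T, fun g => hT g⟩
  refine ⟨c, ?_⟩
  ext x
  have := congrArg (fun f => f x) hc
  exact this.symm

lemma exists_hom {G : Type} [Group G] [Fintype G] (V : FDRep ℂ G)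
    (hV : CategoryTheory.Simple V) (H : Subgroup G)
    (hH : ∀ h ∈ H, ∃ c : ℂ, V.ρ h = c • 1) :
    ∃ ψ : H →* ℂˣ, ∀ h : H, V.ρ (h : G) = (ψ h : ℂ) • 1 := by
  have hf := finrank_ne V hV
  have hnt : Nontrivial V := Module.nontrivial_of_finrank_pos (R := ℂ) (Nat.pos_of_ne_zero hf)
  obtain ⟨v, hv⟩ := exists_ne (0 : V)
  have inj : ∀ a b : ℂ, a • (1 : V →ₗ[ℂ] V) = b • 1 → a = b := by
    intro a b hab
    have := congrArg (fun f => f v) hab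
    exact smul_left_injective ℂ hv this
  choose c hc using fun h : H => hH h h.2
  let f : H →* ℂ :=
    { toFun := c
      map_one' := by
        apply inj; rw [← hc]; simp
      map_mul' := by
        intro a b
        apply inj; rw [← hc]
        simp [hc, smul_smul, mul_comm] }
  exact ⟨f.toHomUnits, fun h => by simp [f, hc]⟩

lemma char_scalar {G : Type} [Group G] [Fintype G] (V : FDRep ℂ G) (g : G) (c : ℂ)
    (h : V.ρ g = c • 1) : V.character g = c * V.character 1 := by
  simp [FDRep.character, h]

lemma exists_irred_aux {G : Type} [Group G] [Fintype G] (n : ℕ) :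
    ∀ (M : Type) [AddCommGroup M] [Module ℂ M] [FiniteDimensional ℂ M]
      (ρ : Representation ℂ G M), Module.finrank ℂ M = n → Nontrivial M →
      ∃ V : FDRep ℂ G, CategoryTheory.Simple V ∧
        ∀ g (c : ℂ), ρ g = c • 1 → V.ρ g = c • 1 := by
  induction n using Nat.strong_induction_on with
  | _ n ih =>
    intro M _ _ _ ρ hn hM
    by_cases hirr : IsIrreducible ρ
    · refine ⟨FDRep.of ρ, ?_, fun g c h => by simpa using h⟩
      rw [FDRep.simple_iff_char_is_norm_one]
      have hne : (Nat.card G : ℂ) ≠ 0 := by simp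
      let _ : Invertible (Nat.card G : ℂ) := invertibleOfNonzero hne
      have h := Representation.char_orthonormal ρ ρ
      rw [if_pos ⟨Representation.Equiv.refl ρ⟩, inv_mul_eq_one₀ hne] at h
      exact h.symm
    · have hnt : Nontrivial (Subrepresentation ρ) := by
        refine ⟨⊥, ⊤, fun h => ?_⟩
        obtain ⟨v, hv⟩ := exists_ne (0 : M)
        have h2 : v ∈ (⊤ : Subrepresentation ρ) := trivial
        rw [← h] at h2
        exact hv h2
      have : ∃ σ : Subrepresentation ρ, σ ≠ ⊥ ∧ σ ≠ ⊤ := by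
        by_contra hcon
        push Not at hcon
        exact hirr ⟨fun a => or_iff_not_imp_left.2 (hcon a)⟩
      obtain ⟨σ, hb, ht⟩ := this
      have hlt : σ.toSubmodule < ⊤ := by
        rw [lt_top_iff_ne_top]
        intro h
        exact ht (Subrepresentation.toSubmodule_injective h)
      have hbot : σ.toSubmodule ≠ ⊥ := by
        intro h
        exact hb (Subrepresentation.toSubmodule_injective h)
      obtain ⟨V, hV, hVg⟩ := ih (Module.finrank ℂ σ.toSubmodule)
        (hn ▸ Submodule.finrank_lt hlt.ne) σ.toSubmodule σ.toRepresentation rfl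
        (Submodule.nontrivial_iff_ne_bot.2 hbot)
      refine ⟨V, hV, fun g c h => hVg g c ?_⟩
      ext x
      have := congrArg (fun f => f (x : M)) h
      exact this

/-- the induced space -/
def indSpace {G : Type} [Group G] (H : Subgroup G) (ψ : H →* ℂˣ) : Submodule ℂ (G → ℂ) where
  carrier := {f | ∀ (h : H) (g : G), f (h * g) = ψ h * f g}
  add_mem' := by
    intro a b ha hb h g
    simp [ha h g, hb h g, mul_add]
  zero_mem' := by intro h g; simp
  smul_mem' := by
    intro c f hf h g
    simp [hf h g]; ring

def indRep {G : Type} [Group G] (H : Subgroup G) (ψ : H →* ℂˣ) :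
    Representation ℂ G (indSpace H ψ) where
  toFun x :=
    { toFun := fun f => ⟨fun g => f.1 (g * x), fun h g => by
        simpa [mul_assoc] using f.2 h (g * x)⟩
      map_add' := fun a b => rfl
      map_smul' := fun a b => rfl }
  map_one' := by ext f g; simp
  map_mul' x y := by ext f g; simp [mul_assoc]

lemma exists_irred {G : Type} [Group G] [Fintype G] (H : Subgroup G) (ψ : H →* ℂˣ)
    (hinv : ∀ (h : H) (g : G), ∃ h' : H, (h' : G) = g * h * g⁻¹ ∧ ψ h' = ψ h) :
    ∃ V : FDRep ℂ G, CategoryTheory.Simple V ∧ ∀ h : H, V.ρ (h : G) = (ψ h : ℂ) • 1 := by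
  classical
  have hnt : Nontrivial (indSpace H ψ) := by
    refine ⟨⟨fun g => if hg : g ∈ H then (ψ ⟨g, hg⟩ : ℂ) else 0, ?_⟩, 0, ?_⟩
    · intro h g
      by_cases hg : g ∈ H
      · have h2 : (h : G) * g ∈ H := H.mul_mem h.2 hg
        have h3 : (⟨(h : G) * g, h2⟩ : H) = h * ⟨g, hg⟩ := rfl
        simp only [dif_pos hg, dif_pos h2]
        rw [h3, map_mul]; simp
      · have h2 : (h : G) * g ∉ H := by
          rwa [H.mul_mem_cancel_left h.2]
        simp only [dif_neg hg, dif_neg h2, mul_zero]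
    · intro h
      have := congrFun (congrArg Subtype.val h) 1
      simp [H.one_mem] at this
  obtain ⟨V, hV, h⟩ := exists_irred_aux _ (indSpace H ψ) (indRep H ψ) rfl hnt
  refine ⟨V, hV, fun w => h _ _ ?_⟩
  ext f g
  obtain ⟨h', e1, e2⟩ := hinv w g
  have := f.2 h' g
  rw [e1, e2] at this
  simpa [indRep] using this

/-- The kernel of a central character, as a subgroup of `G`. -/
def KK {G : Type} [Group G] (l : Subgroup.center G →* ℂˣ) : Subgroup G :=
  l.ker.map (Subgroup.center G).subtype

lemma mem_KK {G : Type} [Group G] (l : Subgroup.center G →* ℂˣ) (z : Subgroup.center G) :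
    (z : G) ∈ KK l ↔ l z = 1 := by
  simp [KK]

lemma KK_le {G : Type} [Group G] (l : Subgroup.center G →* ℂˣ) :
    KK l ≤ Subgroup.center G := by
  intro x hx
  obtain ⟨y, _, rfl⟩ := hx
  exact y.2

lemma normal_of_le {G : Type} [Group G] (K : Subgroup G) (h : K ≤ Subgroup.center G) :
    K.Normal := by
  refine ⟨fun n hn g => ?_⟩
  have := Subgroup.mem_center_iff.1 (h hn) g
  rw [this]; simpa using hn

instance {G : Type} [Group G] (l : Subgroup.center G →* ℂˣ) : (KK l).Normal :=
  normal_of_le _ (KK_le l)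

/-- The preimage of the center of `G / ker l`. -/
def WW {G : Type} [Group G] (l : Subgroup.center G →* ℂˣ) : Subgroup G :=
  (Subgroup.center (G ⧸ KK l)).comap (QuotientGroup.mk' (KK l))

lemma mem_WW {G : Type} [Group G] (l : Subgroup.center G →* ℂˣ) (g : G) :
    g ∈ WW l ↔ ∀ x : G, ⁅x, g⁆ ∈ KK l := by
  rw [WW, Subgroup.mem_comap, Subgroup.mem_center_iff]
  rw [(QuotientGroup.mk'_surjective (KK l)).forall]
  refine forall_congr' fun x => ?_
  rw [← commutatorElement_eq_one_iff_mul_comm, ← map_commutatorElement,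
    ← MonoidHom.mem_ker, QuotientGroup.ker_mk']

lemma center_le_WW {G : Type} [Group G] (l : Subgroup.center G →* ℂˣ) :
    Subgroup.center G ≤ WW l := by
  intro z hz
  rw [mem_WW]
  intro x
  rw [commutatorElement_eq_one_iff_mul_comm.2 (Subgroup.mem_center_iff.1 hz x)]
  exact (KK l).one_mem

lemma WW_eq_top {G : Type} [Group G] (hZ : Subgroup.center G = commutator G)
    (l : Subgroup.center G →* ℂˣ) : WW l = ⊤ ↔ l = 1 := by
  constructor
  · intro h
    have h1 : commutator G ≤ KK l := by
      rw [commutator_def, Subgroup.commutator_le]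
      intro a _ b _
      exact (mem_WW l b).1 (h ▸ Subgroup.mem_top b) a
    ext z
    rw [(mem_KK l z).1 (h1 (hZ ▸ z.2))]
    rfl
  · rintro rfl
    rw [eq_top_iff]
    intro g _
    rw [mem_WW]
    intro x
    have : ⁅x, g⁆ ∈ Subgroup.center G := by
      rw [hZ]; exact Subgroup.commutator_mem_commutator (Subgroup.mem_top _) (Subgroup.mem_top _)
    exact (mem_KK 1 ⟨_, this⟩).2 rfl

/-- `V` lies over the central character `l`. -/
def Over {G : Type} [Group G] (V : FDRep ℂ G) (l : Subgroup.center G →* ℂˣ) : Prop :=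
  ∀ z : Subgroup.center G, V.ρ (z : G) = (l z : ℂ) • 1

lemma exists_over {G : Type} [Group G] [Fintype G] (V : FDRep ℂ G)
    (hV : CategoryTheory.Simple V) : ∃ l, Over V l := by
  apply exists_hom V hV
  intro z hz
  apply schur V hV
  intro g
  change V.ρ z * V.ρ g = V.ρ g * V.ρ z
  rw [← map_mul, ← map_mul, Subgroup.mem_center_iff.1 hz g]

lemma core {G : Type} [Group G] [Fintype G] (hZ : Subgroup.center G = commutator G)
    (V : FDRep ℂ G) (hV : CategoryTheory.Simple V)
    (l : Subgroup.center G →* ℂˣ) (hl : Over V l) :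
    (∃ ψ : WW l →* ℂˣ, (∀ w : WW l, V.ρ (w : G) = (ψ w : ℂ) • 1) ∧
      (∀ (z : G) (h : z ∈ Subgroup.center G), ψ ⟨z, center_le_WW l h⟩ = l ⟨z, h⟩)) ∧
    (∀ g ∉ WW l, V.character g = 0) ∧
    (Module.finrank ℂ V) ^ 2 * Nat.card (WW l) = Nat.card G := by
  have hf := finrank_ne V hV
  have hf' : (Module.finrank ℂ V : ℂ) ≠ 0 := by exact_mod_cast hf
  have hcomm : ∀ x g : G, ⁅x, g⁆ ∈ Subgroup.center G := fun x g => by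
    rw [hZ]; exact Subgroup.commutator_mem_commutator (Subgroup.mem_top _) (Subgroup.mem_top _)
  have hcg : ∀ x g : G, x * g = ⁅x, g⁆ * (g * x) := fun x g => by
    simp [commutatorElement_def, mul_assoc]
  obtain ⟨ψ, hψ⟩ := exists_hom V hV (WW l) (by
    intro w hw
    apply schur V hV
    intro g
    change V.ρ w * V.ρ g = V.ρ g * V.ρ w
    have h1 := (mem_KK l ⟨_, hcomm g w⟩).1 ((mem_WW l w).1 hw g)
    have h2 := hl ⟨_, hcomm g w⟩
    rw [h1] at h2
    rw [← map_mul, ← map_mul, hcg g w, map_mul (V.ρ) ⁅g, w⁆]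
    simp only at h2
    rw [h2]; simp)
  have hv : ∀ g ∉ WW l, V.character g = 0 := by
    intro g hg
    rw [mem_WW] at hg
    push Not at hg
    obtain ⟨x, hx⟩ := hg
    have h1 : l ⟨_, hcomm x g⟩ ≠ 1 := fun h => hx ((mem_KK l ⟨_, hcomm x g⟩).2 h)
    have h2 := hl ⟨_, hcomm x g⟩
    have h3 := V.char_conj g x
    have h4 : x * g * x⁻¹ = ⁅x, g⁆ * g := by simp [commutatorElement_def]
    rw [h4] at h3
    simp only at h2
    have h5 : V.character (⁅x, g⁆ * g) = (l ⟨_, hcomm x g⟩ : ℂ) * V.character g := by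
      unfold FDRep.character
      rw [map_mul, h2]; simp
    rw [h5] at h3
    have h6 : ((l ⟨_, hcomm x g⟩ : ℂ) - 1) * V.character g = 0 := by
      rw [sub_mul, h3]; simp
    rcases mul_eq_zero.1 h6 with h | h
    · exact absurd (Units.ext (by simpa using sub_eq_zero.1 h)) h1
    · exact h
  refine ⟨⟨ψ, hψ, ?_⟩, hv, ?_⟩
  · intro z hz
    have h1 := char_scalar V z _ (hψ ⟨z, center_le_WW l hz⟩)
    have h2 := char_scalar V z _ (hl ⟨z, hz⟩)
    rw [h1, FDRep.char_one] at h2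
    exact Units.ext (mul_right_cancel₀ hf' h2)
  · classical
    have h1 := (FDRep.simple_iff_char_is_norm_one V).1 hV
    have h2 : ∀ g : G, V.character g * V.character g⁻¹ =
        if g ∈ WW l then (Module.finrank ℂ V : ℂ) ^ 2 else 0 := by
      intro g
      split_ifs with hg
      · have e1 := char_scalar V g _ (hψ ⟨g, hg⟩)
        have e2 := char_scalar V g⁻¹ _ (hψ ⟨g, hg⟩⁻¹)
        rw [e1, e2, FDRep.char_one, map_inv]
        have := Units.mul_inv (ψ ⟨g, hg⟩)
        linear_combination (Module.finrank ℂ V : ℂ) ^ 2 * this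
      · rw [hv g hg, zero_mul]
    simp_rw [h2] at h1
    rw [← Finset.sum_filter, Finset.sum_const, nsmul_eq_mul] at h1
    have h3 : (Finset.univ.filter (· ∈ WW l)).card = Nat.card (WW l) := by
      rw [Nat.card_eq_fintype_card, Fintype.card_subtype]
    rw [h3] at h1
    have : ((Module.finrank ℂ V ^ 2 * Nat.card (WW l) : ℕ) : ℂ) = (Nat.card G : ℕ) := by
      rw [← h1]; push_cast; ring
    exact_mod_cast this

lemma numeric {p d w : ℕ} (hp : p.Prime) (h : d ^ 2 * w = p ^ 5) (h2 : p ^ 2 ≤ w)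
    (hw : w ≠ p ^ 5) : d = p ∧ w = p ^ 3 := by
  have hd : d ∣ p ^ 5 := ⟨d * w, by rw [← h]; ring⟩
  obtain ⟨k, hk, rfl⟩ := (Nat.dvd_prime_pow hp).1 hd
  have hpos := hp.pos
  have hp1 := hp.one_lt
  rcases k with _ | _ | k
  · simp at h; exact absurd h hw
  · refine ⟨by simp, ?_⟩
    have : p ^ 2 * w = p ^ 2 * p ^ 3 := by rw [← pow_add]; simpa using h
    exact Nat.eq_of_mul_eq_mul_left (by positivity) this
  · exfalso
    have h3 : p ^ 4 * (p ^ (2 * k) * w) = p ^ 4 * p := by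
      rw [← pow_succ, ← h]; ring
    have h4 := Nat.eq_of_mul_eq_mul_left (by positivity) h3
    have h5 : 1 ≤ p ^ (2 * k) := Nat.one_le_pow _ _ hpos
    nlinarith

lemma card_ext {A : Type} [Group A] [Finite A] (hc : ∀ a b : A, a * b = b * a)
    (B : Subgroup A) (l : B →* ℂˣ) :
    Nat.card {ψ : A →* ℂˣ // ∀ b : B, ψ b = l b} = B.index := by
  let _ : CommGroup A := { ‹Group A› with mul_comm := hc }
  have hs := MonoidHom.domRestrict_surjective ℂ B
  have hk := CommGroup.card_domRestrictHom_ker ℂ B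
  rw [Subgroup.index, ← hk]
  refine Nat.card_congr (Equiv.trans (Equiv.subtypeEquivRight ?_)
    (MonoidHom.fiberEquivKerOfSurjective hs l))
  intro ψ
  simp only [Set.mem_preimage, Set.mem_singleton_iff, MonoidHom.ext_iff]
  rfl

section main

variable {p : ℕ} (hp : p.Prime) {G : Type} [Group G] [Fintype G]
    (hcard : Nat.card G = p ^ 5)
    (hZ : Subgroup.center G = commutator G)
    (hZcard : Nat.card (Subgroup.center G) = p ^ 2)
    (hZexp : ∀ a ∈ Subgroup.center G, a ^ p = 1)

include hp hcard hZ hZcard in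
lemma dims (V : FDRep ℂ G) (hV : CategoryTheory.Simple V) (l : Subgroup.center G →* ℂˣ)
    (hl : Over V l) (h1 : l ≠ 1) :
    Module.finrank ℂ V = p ∧ Nat.card (WW l) = p ^ 3 := by
  obtain ⟨-, -, h⟩ := core hZ V hV l hl
  rw [hcard] at h
  refine numeric hp h ?_ ?_
  · rw [← hZcard]
    exact Nat.card_le_card_of_injective _ (Subgroup.inclusion_injective (center_le_WW l))
  · intro hw
    rw [← hcard] at hw
    exact h1 ((WW_eq_top hZ l).1 (Subgroup.eq_top_of_card_eq _ hw))

include hp hcard hZ hZcard in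
lemma card_WW (l : Subgroup.center G →* ℂˣ) (h1 : l ≠ 1) : Nat.card (WW l) = p ^ 3 := by
  obtain ⟨V, hV, hl⟩ := exists_irred (Subgroup.center G) l (by
    intro h g
    refine ⟨h, ?_, rfl⟩
    rw [Subgroup.mem_center_iff.1 h.2 g]; simp)
  exact (dims hp hcard hZ hZcard V hV l hl h1).2

include hZ in
lemma over_ne_one (V : FDRep ℂ G) (hV : CategoryTheory.Simple V)
    (l : Subgroup.center G →* ℂˣ) (hl : Over V l) (h1 : V.character 1 ≠ 1) : l ≠ 1 := by
  intro h
  obtain ⟨-, -, h2⟩ := core hZ V hV l hl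
  rw [(WW_eq_top hZ l).2 h, Subgroup.card_top] at h2
  have h3 : Module.finrank ℂ V ^ 2 = 1 :=
    Nat.eq_of_mul_eq_mul_right (Nat.card_pos (α := G)) (by rw [h2, one_mul])
  apply h1
  have h4 : Module.finrank ℂ V = 1 := by nlinarith
  rw [FDRep.char_one, h4]
  simp

include hp hZcard hZexp in
omit [Fintype G] in
lemma card_KK (l : Subgroup.center G →* ℂˣ) (h1 : l ≠ 1) : Nat.card (KK l) = p := by
  have e : Nat.card (KK l) = Nat.card l.ker :=
    Subgroup.card_map_of_injective (Subgroup.subtype_injective _)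
  have : NeZero p := ⟨hp.ne_zero⟩
  have h2 : l.range ≤ rootsOfUnity p ℂ := by
    rintro _ ⟨z, rfl⟩
    rw [mem_rootsOfUnity, ← map_pow]
    have : z ^ p = 1 := Subtype.ext (by simpa using hZexp z z.2)
    rw [this, map_one]
  have h3 := Subgroup.card_dvd_of_le h2
  rw [Complex.card_rootsOfUnity] at h3
  have h4 : Nat.card l.range = p := by
    rcases (Nat.dvd_prime hp).1 h3 with h | h
    · exfalso
      apply h1
      rw [Subgroup.card_eq_one, MonoidHom.range_eq_bot_iff] at h
      exact h
    · exact h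
  have h5 := l.ker.card_mul_index
  rw [Subgroup.index_ker, h4, hZcard, pow_two] at h5
  rw [e]
  exact Nat.eq_of_mul_eq_mul_right hp.pos h5

include hp hcard hZ hZcard in
lemma card_psi (l : Subgroup.center G →* ℂˣ) (h1 : l ≠ 1) :
    Nat.card {ψ : WW l →* ℂˣ // ∀ (z : G) (h : z ∈ Subgroup.center G),
      ψ ⟨z, center_le_WW l h⟩ = l ⟨z, h⟩} = p := by
  have hW := card_WW hp hcard hZ hZcard l h1
  let B : Subgroup (WW l) := (Subgroup.center G).subgroupOf (WW l)
  have hB : Nat.card B = p ^ 2 := by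
    rw [← hZcard]
    exact Nat.card_congr (Subgroup.subgroupOfEquivOfLe (center_le_WW l)).toEquiv
  have hi : B.index = p := by
    have := B.card_mul_index
    rw [hB, hW, pow_succ p 2] at this
    exact Nat.eq_of_mul_eq_mul_left (pow_pos hp.pos 2) this
  have hBc : B ≤ Subgroup.center (WW l) := by
    intro b hb
    rw [Subgroup.mem_center_iff]
    intro g
    exact Subtype.ext (Subgroup.mem_center_iff.1 (Subgroup.mem_subgroupOf.1 hb) g)
  have hBn : B.Normal := normal_of_le B hBc
  have : Fact p.Prime := ⟨hp⟩
  have hcyc : IsCyclic (WW l ⧸ B) := isCyclic_of_prime_card (p := p) hi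
  have hcomm : ∀ a b : WW l, a * b = b * a :=
    (MonoidHom.isMulCommutative_of_isCyclic_of_ker_le_center (QuotientGroup.mk' B) (by
      rw [QuotientGroup.ker_mk']; exact hBc)).is_comm.comm
  rw [← hi, ← card_ext hcomm B (l.comp (Subgroup.subgroupOfEquivOfLe (center_le_WW l)).toMonoidHom)]
  refine Nat.card_congr (Equiv.subtypeEquivRight fun ψ => ?_)
  constructor
  · intro h b
    exact h b.1.1 (Subgroup.mem_subgroupOf.1 b.2)
  · intro h z hz
    exact h ⟨⟨z, center_le_WW l hz⟩, Subgroup.mem_subgroupOf.2 hz⟩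

end main

lemma sum_quot {G : Type} [Group G] [Fintype G] (K : Subgroup G) [K.Normal]
    [Fintype (G ⧸ K)] (f : G ⧸ K → ℂ) :
    ∑ g : G, f (QuotientGroup.mk g) = Nat.card K * ∑ q, f q := by
  classical
  rw [← Finset.sum_fiberwise (s := Finset.univ) (g := fun g : G => (QuotientGroup.mk g : G ⧸ K)),
    Finset.mul_sum]
  refine Finset.sum_congr rfl fun q _ => ?_
  rw [Finset.sum_congr rfl (g := fun _ => f q)
    (fun x hx => by rw [(Finset.mem_filter.1 hx).2]), Finset.sum_const, nsmul_eq_mul]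
  congr 2
  have e := MonoidHom.fiberEquivKerOfSurjective (QuotientGroup.mk'_surjective K) q
  have h1 := Nat.card_congr e
  rw [QuotientGroup.ker_mk'] at h1
  rw [← h1, Nat.card_eq_fintype_card, ← Set.toFinset_card]
  congr 1
  ext x
  rw [Set.mem_toFinset]
  simp

lemma deflate {G : Type} [Group G] [Fintype G] (V : FDRep ℂ G)
    (hV : CategoryTheory.Simple V) (K : Subgroup G) [K.Normal] (hK : ∀ k ∈ K, V.ρ k = 1) :
    ∃ χ : G ⧸ K → ℂ, IsIrredCharacter χ ∧
      V.character = χ ∘ (QuotientGroup.mk : G → G ⧸ K) := by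
  classical
  let r : Representation ℂ (G ⧸ K) V := QuotientGroup.lift K V.ρ hK
  have hr : ∀ g : G, (FDRep.of r).character (QuotientGroup.mk g) = V.character g := by
    intro g; rfl
  refine ⟨(FDRep.of r).character, ⟨FDRep.of r, ?_, rfl⟩, ?_⟩
  · let _ : Fintype (G ⧸ K) := Fintype.ofFinite _
    rw [FDRep.simple_iff_char_is_norm_one]
    have h1 := (FDRep.simple_iff_char_is_norm_one V).1 hV
    have h2 := sum_quot K
      (fun q => (FDRep.of r).character q * (FDRep.of r).character q⁻¹)
    simp_rw [← QuotientGroup.mk_inv, hr] at h2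
    rw [h1, Subgroup.card_eq_card_quotient_mul_card_subgroup K] at h2
    push_cast at h2
    rw [mul_comm] at h2
    exact (mul_left_cancel₀ (Nat.cast_ne_zero.2 Nat.card_pos.ne') h2).symm
  · funext g; exact (hr g).symm

lemma ker_eq {G : Type} [Group G] [Fintype G] (V : FDRep ℂ G) (hV : CategoryTheory.Simple V)
    (l : Subgroup.center G →* ℂˣ) (hl : Over V l) :
    (KK l : Set G) = {g | V.character g = V.character 1} ∩ (Subgroup.center G : Set G) := by
  have h0 : V.character 1 ≠ 0 := by
    rw [FDRep.char_one]; exact Nat.cast_ne_zero.2 (finrank_ne V hV)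
  have key : ∀ z : Subgroup.center G, (z : G) ∈ KK l ↔ V.character z = V.character 1 := by
    intro z
    rw [mem_KK, char_scalar V z _ (hl z), mul_eq_right₀ h0, Units.val_eq_one]
  ext g
  constructor
  · intro hg
    exact ⟨(key ⟨g, KK_le l hg⟩).1 hg, KK_le l hg⟩
  · rintro ⟨h1, h2⟩
    exact (key ⟨g, h2⟩).2 h1

section main2

variable {p : ℕ} (hp : p.Prime) {G : Type} [Group G] [Fintype G]
    (hcard : Nat.card G = p ^ 5)
    (hZ : Subgroup.center G = commutator G)
    (hZcard : Nat.card (Subgroup.center G) = p ^ 2)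
    (hZexp : ∀ a ∈ Subgroup.center G, a ^ p = 1)

/-- Extensions of a central character to `WW l`. -/
abbrev Ext {G : Type} [Group G] (l : Subgroup.center G →* ℂˣ) : Type :=
  {ψ : WW l →* ℂˣ // ∀ (z : G) (h : z ∈ Subgroup.center G),
      ψ ⟨z, center_le_WW l h⟩ = l ⟨z, h⟩}

open Classical in
/-- The explicit character formula. -/
noncomputable def FF (p : ℕ) {G : Type} [Group G] (l : Subgroup.center G →* ℂˣ)
    (ψ : WW l →* ℂˣ) : G → ℂ :=
  fun g => if h : g ∈ WW l then (ψ ⟨g, h⟩ : ℂ) * p else 0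

include hp hcard hZ hZcard in
lemma char_eq_FF (V : FDRep ℂ G) (hV : CategoryTheory.Simple V)
    (l : Subgroup.center G →* ℂˣ) (hl : Over V l) (h1 : l ≠ 1) (ψ : WW l →* ℂˣ)
    (hψ : ∀ w : WW l, V.ρ (w : G) = (ψ w : ℂ) • 1) : V.character = FF p l ψ := by
  funext g
  unfold FF
  split_ifs with h
  · rw [char_scalar V g _ (hψ ⟨g, h⟩), FDRep.char_one,
      (dims hp hcard hZ hZcard V hV l hl h1).1]
  · exact (core hZ V hV l hl).2.1 g h

include hp hcard hZ hZcard in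
lemma FF_irred (l : Subgroup.center G →* ℂˣ) (h1 : l ≠ 1) (ψ : Ext l) :
    IsIrredCharacter (FF p l ψ.1) ∧ FF p l ψ.1 1 ≠ 1 := by
  obtain ⟨ψ, hψ⟩ := ψ
  have hcomm : ∀ x g : G, ⁅x, g⁆ ∈ Subgroup.center G := fun x g => by
    rw [hZ]; exact Subgroup.commutator_mem_commutator (Subgroup.mem_top _) (Subgroup.mem_top _)
  obtain ⟨V, hV, hVψ⟩ := exists_irred (WW l) ψ (by
    intro w g
    have h2 := (mem_KK l ⟨_, hcomm g w⟩).1 ((mem_WW l w).1 w.2 g)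
    refine ⟨⟨⁅g, (w : G)⁆, center_le_WW l (hcomm g w)⟩ * w, ?_, ?_⟩
    · simp [commutatorElement_def]
    · rw [map_mul, hψ _ (hcomm g w), h2, one_mul])
  have hl : Over V l := by
    intro z
    rw [← hψ z z.2]
    exact hVψ ⟨z, center_le_WW l z.2⟩
  have e := char_eq_FF hp hcard hZ hZcard V hV l hl h1 ψ hVψ
  refine ⟨⟨V, hV, e⟩, ?_⟩
  rw [← e, FDRep.char_one, (dims hp hcard hZ hZcard V hV l hl h1).1]
  exact_mod_cast hp.one_lt.ne'

include hp in
omit [Fintype G] in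
lemma FF_inj (l l' : Subgroup.center G →* ℂˣ) (ψ : Ext l) (ψ' : Ext l')
    (h : FF p l ψ.1 = FF p l' ψ'.1) :
    (⟨l, ψ⟩ : Σ l : Subgroup.center G →* ℂˣ, Ext l) = ⟨l', ψ'⟩ := by
  have hp0 : (p : ℂ) ≠ 0 := Nat.cast_ne_zero.2 hp.ne_zero
  have hll : l = l' := by
    ext z
    have := congrFun h z
    simp only [FF, dif_pos (center_le_WW l z.2), dif_pos (center_le_WW l' z.2), ψ.2 z z.2,
      ψ'.2 z z.2] at this
    exact mul_right_cancel₀ hp0 this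
  subst hll
  have : ψ = ψ' := by
    apply Subtype.ext
    ext w
    have := congrFun h w
    simp only [FF, dif_pos w.2] at this
    exact mul_right_cancel₀ hp0 this
  rw [this]

include hp hcard hZ hZcard in
lemma count : Nat.card {χ : G → ℂ // IsIrredCharacter χ ∧ χ 1 ≠ 1} = p ^ 3 - p := by
  let T := Σ l : {l : Subgroup.center G →* ℂˣ // l ≠ 1}, Ext l.1
  let f : T → {χ : G → ℂ // IsIrredCharacter χ ∧ χ 1 ≠ 1} :=
    fun t => ⟨FF p t.1.1 t.2.1, FF_irred hp hcard hZ hZcard t.1.1 t.1.2 t.2⟩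
  have hf : Function.Bijective f := by
    constructor
    · rintro ⟨⟨l, hl⟩, ψ⟩ ⟨⟨l', hl'⟩, ψ'⟩ h
      have h2 := FF_inj hp l l' ψ ψ' (congrArg Subtype.val h)
      obtain ⟨h3, h4⟩ := Sigma.mk.inj_iff.1 h2
      subst h3
      rw [eq_of_heq h4]
    · rintro ⟨χ, ⟨V, hV, rfl⟩, h1⟩
      obtain ⟨l, hl⟩ := exists_over V hV
      have hl1 := over_ne_one hZ V hV l hl h1
      obtain ⟨⟨ψ, hψ, hψl⟩, -, -⟩ := core hZ V hV l hl
      exact ⟨⟨⟨l, hl1⟩, ⟨ψ, hψl⟩⟩,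
        Subtype.ext (char_eq_FF hp hcard hZ hZcard V hV l hl hl1 ψ hψ).symm⟩
  rw [← Nat.card_eq_of_bijective f hf]
  have hc : Nat.card (Subgroup.center G →* ℂˣ) = p ^ 2 := by
    rw [← hZcard]
    let _ : CommGroup (Subgroup.center G) :=
      { (inferInstance : Group (Subgroup.center G)) with
        mul_comm := fun a b => Subtype.ext (Subgroup.mem_center_iff.1 b.2 a) }
    exact CommGroup.card_monoidHom_of_hasEnoughRootsOfUnity (Subgroup.center G) ℂ
  have : Finite (Subgroup.center G →* ℂˣ) :=
    Nat.finite_of_card_ne_zero (by rw [hc]; exact (pow_pos hp.pos 2).ne')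
  have hfe : ∀ l : {l : Subgroup.center G →* ℂˣ // l ≠ 1}, Finite (Ext l.1) := fun l =>
    Nat.finite_of_card_ne_zero
      (by rw [card_psi hp hcard hZ hZcard l.1 l.2]; exact hp.ne_zero)
  classical
  let _ : Fintype (Subgroup.center G →* ℂˣ) := Fintype.ofFinite _
  rw [Nat.card_sigma]
  rw [Finset.sum_congr rfl (g := fun _ => p)
    (fun l _ => card_psi hp hcard hZ hZcard l.1 l.2)]
  rw [Finset.sum_const, smul_eq_mul, Finset.card_univ]
  have h5 : Fintype.card {l : Subgroup.center G →* ℂˣ // l ≠ 1} = p ^ 2 - 1 := by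
    rw [← hc, Nat.card_eq_fintype_card]
    simp [Fintype.card_subtype_compl]
  rw [h5, Nat.sub_mul, one_mul, ← pow_succ]

end main2

end Stmt5

theorem stmt_5 {p : ℕ} (hp : p.Prime) (hodd : Odd p)
    {G : Type} [Group G] [Fintype G]
    (hcard : Nat.card G = p ^ 5)
    (hZG' : Subgroup.center G = commutator G)
    (hZcard : Nat.card (Subgroup.center G) = p ^ 2)
    (hZexp : ∀ a ∈ Subgroup.center G, a ^ p = 1) :
    (∀ χ : G → ℂ, IsIrredCharacter χ → χ 1 ≠ 1 →
      ∃ (K : Subgroup G) (hn : K.Normal),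
        (K : Set G) = {g | χ g = χ 1} ∩ (Subgroup.center G : Set G) ∧
        Nat.card K = p ∧
        (haveI := hn;
         ∃ χbar : G ⧸ K → ℂ, IsIrredCharacter χbar ∧ χbar 1 ≠ 1 ∧
           χ = χbar ∘ (QuotientGroup.mk : G → G ⧸ K))) ∧
    Function.Bijective
      (fun x : {x : Subgroup G × (G → ℂ) //
          x.1 ≤ Subgroup.center G ∧ Nat.card x.1 = p ∧
          IsIrredCharacter x.2 ∧ x.2 1 ≠ 1 ∧ ∀ k ∈ x.1, x.2 k = x.2 1} =>
        (⟨x.1.2, x.2.2.2.1, x.2.2.2.2.1⟩ :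
          {χ : G → ℂ // IsIrredCharacter χ ∧ χ 1 ≠ 1})) ∧
    Nat.card {χ : G → ℂ // IsIrredCharacter χ ∧ χ 1 ≠ 1} = p ^ 3 - p := by
  have part1 : ∀ χ : G → ℂ, IsIrredCharacter χ → χ 1 ≠ 1 →
      ∃ (K : Subgroup G) (hn : K.Normal),
        (K : Set G) = {g | χ g = χ 1} ∩ (Subgroup.center G : Set G) ∧
        Nat.card K = p ∧
        (haveI := hn;
         ∃ χbar : G ⧸ K → ℂ, IsIrredCharacter χbar ∧ χbar 1 ≠ 1 ∧
           χ = χbar ∘ (QuotientGroup.mk : G → G ⧸ K)) := by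
    rintro χ ⟨V, hV, rfl⟩ h1
    obtain ⟨l, hl⟩ := Stmt5.exists_over V hV
    have hl1 := Stmt5.over_ne_one hZG' V hV l hl h1
    refine ⟨Stmt5.KK l, inferInstance, Stmt5.ker_eq V hV l hl,
      Stmt5.card_KK hp hZcard hZexp l hl1, ?_⟩
    obtain ⟨χ, hχ, e⟩ := Stmt5.deflate V hV (Stmt5.KK l) (by
      intro k hk
      have hkz := Stmt5.KK_le l hk
      have h2 := (Stmt5.mem_KK l ⟨k, hkz⟩).1 hk
      have h3 := hl ⟨k, hkz⟩
      rw [h2] at h3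
      simpa using h3)
    refine ⟨χ, hχ, ?_, e⟩
    rw [e] at h1
    exact h1
  refine ⟨part1, ⟨?_, ?_⟩, Stmt5.count hp hcard hZG' hZcard⟩
  · rintro ⟨⟨K, χ⟩, hK, hKp, hχ, h1, hk⟩ ⟨⟨K', χ'⟩, hK', hKp', hχ', h1', hk'⟩ h
    have e : χ = χ' := congrArg Subtype.val h
    subst e
    obtain ⟨L, -, hL, hLp, -⟩ := part1 χ hχ h1
    have key : ∀ M : Subgroup G, M ≤ Subgroup.center G → Nat.card M = p →
        (∀ k ∈ M, χ k = χ 1) → M = L := by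
      intro M hM hMp hMk
      apply Subgroup.eq_of_le_of_card_ge
      · intro x hx
        have : x ∈ (L : Set G) := by
          rw [hL]; exact ⟨hMk x hx, hM hx⟩
        exact this
      · rw [hMp, hLp]
    have e2 : K = K' := (key K hK hKp hk).trans (key K' hK' hKp' hk').symm
    subst e2
    rfl
  · rintro ⟨χ, hχ, h1⟩
    obtain ⟨L, -, hL, hLp, -⟩ := part1 χ hχ h1
    have hmem : ∀ x ∈ L, χ x = χ 1 ∧ x ∈ Subgroup.center G := by
      intro x hx
      have : x ∈ (L : Set G) := hx
      rw [hL] at this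
      exact this
    exact ⟨⟨(L, χ), fun x hx => (hmem x hx).2, hLp, hχ, h1, fun k hk => (hmem k hk).1⟩, rfl⟩
end

section
/- Let p be a prime and G a finite p-group such that (G, Z(G)) is a Camina pair. Let H be a subgroup of G with [G : H]² = [G : Z(G)], and let ψ be a linear character of H. Then the induced class function ψ^G is an irreducible complex character of G whose kernel does not contain Z(G) if and only if Z(G) ⊆ H and the restriction μ = ψ|_{Z(G)} is a nontrivial character of Z(G). Moreover, in that case ψ^G(g) = [G : H]·μ(g) for g ∈ Z(G) and ψ^G(g) = 0 for g ∉ Z(G). -/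
open scoped Classical in
/-- The class function on `G` induced from a function `ψ` on a subgroup `H`:
`ψ^G(g) = |H|⁻¹ · ∑_{x ∈ G} ψ°(x g x⁻¹)`, where `ψ°` is `ψ` on `H` and `0` off `H`. -/
noncomputable def inducedFn {G : Type} [Group G] (H : Subgroup G) (ψ : H → ℂ) : G → ℂ :=
  fun g => (Nat.card H : ℂ)⁻¹ *
    ∑ᶠ x : G, if h : x * g * x⁻¹ ∈ H then ψ ⟨x * g * x⁻¹, h⟩ else 0

/-- `(G, Z(G))` is a Camina pair: `1 < Z(G) < G` and every `g ∉ Z(G)` is conjugate to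
every element of the coset `g·Z(G)`. -/
def IsCaminaPairCenter (G : Type) [Group G] : Prop :=
  ⊥ < Subgroup.center G ∧ Subgroup.center G < (⊤ : Subgroup G) ∧
    ∀ g : G, g ∉ Subgroup.center G → ∀ z ∈ Subgroup.center G, IsConj g (g * z)

open scoped Classical in
/-- `ψ` extended by zero. -/
noncomputable def extFn {G : Type} [Group G] (H : Subgroup G) (ψ : ↥H →* ℂ) (y : G) : ℂ :=
  if h : y ∈ H then ψ ⟨y, h⟩ else 0

lemma inducedFn_eq {G : Type} [Group G] [Fintype G] (H : Subgroup G) (ψ : ↥H →* ℂ) (g : G) :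
    inducedFn H (fun h => ψ h) g = (Nat.card H : ℂ)⁻¹ * ∑ x : G, extFn H ψ (x * g * x⁻¹) := by
  unfold inducedFn
  rw [finsum_eq_sum_of_fintype]
  rfl

lemma extFn_mem {G : Type} [Group G] (H : Subgroup G) (ψ : ↥H →* ℂ) (y : G) (h : y ∈ H) :
    extFn H ψ y = ψ ⟨y, h⟩ := by
  unfold extFn; rw [dif_pos h]

lemma extFn_not_mem {G : Type} [Group G] (H : Subgroup G) (ψ : ↥H →* ℂ) (y : G) (h : y ∉ H) :
    extFn H ψ y = 0 := by
  unfold extFn; rw [dif_neg h]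

lemma extFn_mul {G : Type} [Group G] (H : Subgroup G) (ψ : ↥H →* ℂ) (h : ↥H) (y : G) :
    extFn H ψ (h * y) = ψ h * extFn H ψ y := by
  by_cases hy : y ∈ H
  · rw [extFn_mem H ψ y hy, extFn_mem H ψ _ (H.mul_mem h.2 hy), ← map_mul]
    rfl
  · rw [extFn_not_mem H ψ y hy, extFn_not_mem H ψ, mul_zero]
    rwa [Subgroup.mul_mem_cancel_left H h.2]

/-- The space of the induced representation. -/
def indSpace {G : Type} [Group G] (H : Subgroup G) (ψ : ↥H →* ℂ) : Submodule ℂ (G → ℂ) where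
  carrier := {f | ∀ (h : ↥H) (x : G), f (h * x) = ψ h * f x}
  add_mem' := by
    intro a b ha hb h x
    simp only [Pi.add_apply, ha h x, hb h x, mul_add]
  zero_mem' := by intro h x; simp
  smul_mem' := by
    intro c a ha h x
    simp only [Pi.smul_apply, smul_eq_mul, ha h x]
    ring

/-- The induced representation: right translation. -/
def indRep {G : Type} [Group G] (H : Subgroup G) (ψ : ↥H →* ℂ) :
    Representation ℂ G (indSpace H ψ) where
  toFun g :=
    { toFun := fun f => ⟨fun x => f.1 (x * g), fun h x => by
        change f.1 (h * x * g) = ψ h * f.1 (x * g)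
        rw [mul_assoc]; exact f.2 h (x * g)⟩
      map_add' := fun a b => rfl
      map_smul' := fun a b => rfl }
  map_one' := by
    ext f x
    simp
  map_mul' a b := by
    ext f x
    simp [mul_assoc]

lemma indRep_apply {G : Type} [Group G] (H : Subgroup G) (ψ : ↥H →* ℂ) (g : G)
    (f : indSpace H ψ) (x : G) : (indRep H ψ g f).1 x = f.1 (x * g) := rfl

lemma trace_indRep {G : Type} [Group G] [Fintype G] (H : Subgroup G) (ψ : ↥H →* ℂ) (g : G) :
    LinearMap.trace ℂ (indSpace H ψ) (indRep H ψ g) = inducedFn H (fun h => ψ h) g := by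
  classical
  let M : Matrix G G ℂ := fun x w => (Nat.card H : ℂ)⁻¹ * extFn H ψ (x * g * w⁻¹)
  have hM : ∀ f x, M.toLin' f x = (Nat.card H : ℂ)⁻¹ * ∑ w, extFn H ψ (x * g * w⁻¹) * f w := by
    intro f x
    rw [Matrix.toLin'_apply, Matrix.mulVec, dotProduct, Finset.mul_sum]
    refine Finset.sum_congr rfl fun w _ => ?_
    simp only [M]; ring
  have hmem : ∀ f, M.toLin' f ∈ indSpace H ψ := by
    intro f h x
    rw [hM, hM, mul_left_comm (ψ h)]
    congr 1
    rw [Finset.mul_sum]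
    refine Finset.sum_congr rfl fun w _ => ?_
    rw [← mul_assoc, ← extFn_mul]
    simp only [mul_assoc]
  have key : indRep H ψ g = M.toLin'.restrict (fun x _ => hmem x) := by
    ext f x
    rw [indRep_apply, LinearMap.coe_restrict_apply, hM]
    have h1 : ∑ w, extFn H ψ (x * g * w⁻¹) * f.1 w
        = ∑ y, extFn H ψ y * f.1 (y⁻¹ * (x * g)) := by
      refine Fintype.sum_equiv ((Equiv.inv G).trans (Equiv.mulLeft (x * g))) _ _ fun w => ?_
      change _ = extFn H ψ (x * g * w⁻¹) * f.1 ((x * g * w⁻¹)⁻¹ * (x * g))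
      congr 2
      group
    have h2 : ∀ y, extFn H ψ y * f.1 (y⁻¹ * (x * g)) = if y ∈ H then f.1 (x * g) else 0 := by
      intro y
      split_ifs with hy
      · rw [extFn_mem H ψ y hy]
        have := f.2 ⟨y, hy⟩ (y⁻¹ * (x * g))
        simp only [mul_inv_cancel_left] at this
        exact this.symm
      · rw [extFn_not_mem H ψ y hy, zero_mul]
    rw [h1, Finset.sum_congr rfl fun y _ => h2 y, ← Finset.sum_filter, Finset.sum_const,
      nsmul_eq_mul, ← Fintype.card_subtype, ← Nat.card_eq_fintype_card]
    have : (Nat.card H : ℂ) ≠ 0 := Nat.cast_ne_zero.2 Nat.card_pos.ne'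
    change _ = (Nat.card H : ℂ)⁻¹ * ((Nat.card H : ℂ) * _)
    field_simp
  rw [key, LinearMap.trace_restrict_eq_of_forall_mem _ _ hmem, Matrix.trace_toLin'_eq,
    inducedFn_eq, Finset.mul_sum]
  rfl

/-- Values on the centre. -/
lemma inducedFn_center {G : Type} [Group G] [Fintype G] (H : Subgroup G) (ψ : ↥H →* ℂ) (g : G)
    (hg : g ∈ Subgroup.center G) :
    inducedFn H (fun h => ψ h) g = (H.index : ℂ) * extFn H ψ g := by
  have hc : ∀ x : G, x * g * x⁻¹ = g := fun x => by
    rw [Subgroup.mem_center_iff.1 hg x, mul_inv_cancel_right]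
  have : (Nat.card H : ℂ) ≠ 0 := Nat.cast_ne_zero.2 Nat.card_pos.ne'
  rw [inducedFn_eq]
  simp only [hc, Finset.sum_const, Finset.card_univ, nsmul_eq_mul, ← Nat.card_eq_fintype_card]
  rw [← H.card_mul_index]
  push_cast
  field_simp

lemma inducedFn_conj {G : Type} [Group G] [Fintype G] (H : Subgroup G) (ψ : ↥H →* ℂ) (a b : G)
    (h : IsConj a b) :
    inducedFn H (fun h => ψ h) a = inducedFn H (fun h => ψ h) b := by
  obtain ⟨c, rfl⟩ := isConj_iff.1 h
  rw [inducedFn_eq, inducedFn_eq]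
  congr 1
  refine (Fintype.sum_equiv (Equiv.mulRight c) _ _ fun w => ?_).symm
  simp [mul_assoc]

lemma inducedFn_mul_center {G : Type} [Group G] [Fintype G] (H : Subgroup G) (ψ : ↥H →* ℂ)
    (g z : G) (hz : z ∈ Subgroup.center G) (hzH : z ∈ H) :
    inducedFn H (fun h => ψ h) (g * z) = ψ ⟨z, hzH⟩ * inducedFn H (fun h => ψ h) g := by
  rw [inducedFn_eq, inducedFn_eq, mul_left_comm (ψ _)]
  congr 1
  rw [Finset.mul_sum]
  refine Finset.sum_congr rfl fun x _ => ?_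
  rw [← extFn_mul]
  congr 1
  rw [← mul_assoc x, Subgroup.mem_center_iff.1 hz]
  simp only [mul_assoc]

lemma inducedFn_vanish {G : Type} [Group G] [Fintype G] (hcp : IsCaminaPairCenter G)
    (H : Subgroup G) (ψ : ↥H →* ℂ) (hle : Subgroup.center G ≤ H)
    (hnt : ∃ z, ∃ hz : z ∈ Subgroup.center G, ψ ⟨z, hle hz⟩ ≠ 1) (g : G)
    (hg : g ∉ Subgroup.center G) : inducedFn H (fun h => ψ h) g = 0 := by
  obtain ⟨z, hz, hne⟩ := hnt
  have h1 := inducedFn_mul_center H ψ g z hz (hle hz)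
  rw [← inducedFn_conj H ψ _ _ (hcp.2.2 g hg z hz)] at h1
  by_contra h0
  exact hne (mul_right_cancel₀ h0 (by rw [one_mul]; exact h1.symm))

lemma simple_center_scalar {G : Type} [Group G] [Fintype G] (V : FDRep ℂ G)
    [CategoryTheory.Simple V] (z : G) (hz : z ∈ Subgroup.center G) :
    ∃ c : ℂ, V.ρ z = c • LinearMap.id := by
  let f : V ⟶ V := ⟨Action.ρ V z, fun g => by
    have := (Action.ρ V).map_mul g z
    have h2 := (Action.ρ V).map_mul z g
    rw [Subgroup.mem_center_iff.1 hz g] at this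
    exact (this.symm.trans h2).symm⟩
  obtain ⟨c, hc⟩ := CategoryTheory.endomorphism_simple_eq_smul_id ℂ f
  refine ⟨c, ?_⟩
  have := congrArg (fun t : V ⟶ V => t.hom.hom.hom) hc
  exact this.symm

theorem stmt_10 {p : ℕ} (hp : p.Prime)
    {G : Type} [Group G] [Fintype G] (hpG : IsPGroup p G)
    (hcp : IsCaminaPairCenter G)
    (H : Subgroup G) (hidx : H.index ^ 2 = (Subgroup.center G).index)
    (ψ : ↥H →* ℂ) :
    ((IsIrredCharacter (inducedFn H fun h => ψ h) ∧
        ∃ z ∈ Subgroup.center G,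
          (inducedFn H fun h => ψ h) z ≠ (inducedFn H fun h => ψ h) 1) ↔
      ∃ hle : Subgroup.center G ≤ H, ∃ z, ∃ hz : z ∈ Subgroup.center G,
        ψ ⟨z, hle hz⟩ ≠ 1) ∧
    ∀ hle : Subgroup.center G ≤ H,
      (∃ z, ∃ hz : z ∈ Subgroup.center G, ψ ⟨z, hle hz⟩ ≠ 1) →
      (∀ g (hg : g ∈ Subgroup.center G),
          (inducedFn H fun h => ψ h) g = (H.index : ℂ) * ψ ⟨g, hle hg⟩) ∧
      ∀ g ∉ Subgroup.center G, (inducedFn H fun h => ψ h) g = 0 := by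
  refine ⟨⟨?_, ?_⟩, ?_⟩
  · rintro ⟨⟨V, hV, hχ⟩, z, hz, hne⟩
    have hidx0 : (H.index : ℂ) ≠ 0 := Nat.cast_ne_zero.2 Subgroup.index_ne_zero_of_finite
    have h1 : inducedFn H (fun h => ψ h) 1 = H.index := by
      rw [inducedFn_center H ψ 1 (Subgroup.one_mem _), extFn_mem H ψ 1 H.one_mem]
      have : (⟨1, H.one_mem⟩ : ↥H) = 1 := rfl
      rw [this, map_one, mul_one]
    have hle : Subgroup.center G ≤ H := by
      intro y hy
      by_contra hyH
      have h0 := inducedFn_center H ψ y hy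
      rw [extFn_not_mem H ψ y hyH, mul_zero] at h0
      obtain ⟨c, hc⟩ := simple_center_scalar V y hy
      have h2 : V.character y = c * V.character 1 := by
        simp only [FDRep.character, hc, map_one, map_smul, smul_eq_mul]
        rfl
      rw [hχ, h0, h1] at h2
      have hc0 : c = 0 := by
        rcases mul_eq_zero.1 h2.symm with h | h
        · exact h
        · exact absurd h hidx0
      rw [hc0, zero_smul] at hc
      have h3 : V.ρ 1 = 0 := by
        rw [← mul_inv_cancel y, map_mul, hc, zero_mul]
      have h4 : V.character 1 = 0 := by
        simp only [FDRep.character, h3, map_zero]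
      rw [hχ, h1] at h4
      exact hidx0 h4
    refine ⟨hle, z, hz, fun h => hne ?_⟩
    rw [inducedFn_center H ψ z hz, extFn_mem H ψ z (hle hz), h, h1, mul_one]
  · rintro ⟨hle, hnt⟩
    have hidx0 : (H.index : ℂ) ≠ 0 := Nat.cast_ne_zero.2 Subgroup.index_ne_zero_of_finite
    have hval : ∀ g (hg : g ∈ Subgroup.center G),
        inducedFn H (fun h => ψ h) g = (H.index : ℂ) * ψ ⟨g, hle hg⟩ := fun g hg => by
      rw [inducedFn_center H ψ g hg, extFn_mem H ψ g (hle hg)]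
    have hψ1 : ψ ⟨1, H.one_mem⟩ = 1 := ψ.map_one
    have hchar : (FDRep.of (indRep H ψ)).character = inducedFn H (fun h => ψ h) := by
      funext g
      exact trace_indRep H ψ g
    refine ⟨⟨FDRep.of (indRep H ψ), ?_, hchar⟩, ?_⟩
    · rw [FDRep.simple_iff_char_is_norm_one, hchar]
      classical
      have h2 : ∀ g : G, inducedFn H (fun h => ψ h) g * inducedFn H (fun h => ψ h) g⁻¹
          = if g ∈ Subgroup.center G then (H.index : ℂ) ^ 2 else 0 := by
        intro g
        split_ifs with hg
        · rw [hval g hg, hval g⁻¹ (Subgroup.inv_mem _ hg)]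
          have : ψ ⟨g, hle hg⟩ * ψ ⟨g⁻¹, hle (Subgroup.inv_mem _ hg)⟩ = 1 := by
            rw [← map_mul, ← hψ1]
            congr 1
            ext
            simp
          linear_combination (H.index : ℂ) ^ 2 * this
        · rw [inducedFn_vanish hcp H ψ hle hnt g hg, zero_mul]
      rw [Finset.sum_congr rfl fun y _ => h2 y, ← Finset.sum_filter, Finset.sum_const,
        nsmul_eq_mul, ← Fintype.card_subtype, ← Nat.card_eq_fintype_card,
        ← (Subgroup.center G).card_mul_index, ← hidx]
      push_cast
      rfl
    · obtain ⟨z, hz, hne⟩ := hnt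
      refine ⟨z, hz, fun h => hne ?_⟩
      rw [hval z hz, hval 1 (Subgroup.one_mem _), hψ1] at h
      exact mul_left_cancel₀ hidx0 h
  · intro hle hnt
    refine ⟨fun g hg => ?_, fun g hg => inducedFn_vanish hcp H ψ hle hnt g hg⟩
    rw [inducedFn_center H ψ g hg, extFn_mem H ψ g (hle hg)]
end

section
/- Let G be a finite p-group such that (G, Z(G)) is a Camina pair and such that the set of degrees of irreducible complex characters of G has exactly two elements. Then G is a VZ-group (every nonlinear irreducible complex character of G vanishes on G ∖ Z(G)) and G' = Z(G). -/
open CategoryTheory Module ComplexOrder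

namespace CaminaAux

/-- Characters of finite groups: value at the inverse is the complex conjugate. -/
lemma char_inv_eq_star {G V : Type} [Group G] [Fintype G] [AddCommGroup V] [Module ℂ V]
    [FiniteDimensional ℂ V] (ρ : Representation ℂ G V) (g : G) :
    ρ.character g⁻¹ = star (ρ.character g) := by
  classical
  let b := Module.finBasis ℂ V
  let M : G → Matrix _ _ ℂ := fun g => LinearMap.toMatrix b b (ρ g)
  have hmul : ∀ x y, M (x * y) = M x * M y := fun x y => by
    simp only [M, map_mul]; exact LinearMap.toMatrix_mul b _ _
  have hone : M 1 = 1 := by simp only [M, map_one]; exact LinearMap.toMatrix_one b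
  have htr : ∀ x, ρ.character x = (M x).trace := fun x => by
    simp only [M, Representation.character]
    exact LinearMap.trace_eq_matrix_trace ℂ b _
  let H := ∑ x : G, (M x).conjTranspose * M x
  have hinv : (M g).conjTranspose * H * M g = H := by
    simp only [H, Finset.mul_sum, Finset.sum_mul]
    rw [← Equiv.sum_comp (Equiv.mulRight g) (fun x => (M x).conjTranspose * M x)]
    refine Finset.sum_congr rfl fun x _ => ?_
    simp [hmul, Matrix.conjTranspose_mul, Matrix.mul_assoc]
  have hpd : H.PosDef := by
    have h1 : H = (M 1).conjTranspose * M 1 + ∑ x ∈ Finset.univ.erase 1, (M x).conjTranspose * M x := by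
      exact (Finset.add_sum_erase Finset.univ (fun x => (M x).conjTranspose * M x)
        (Finset.mem_univ 1)).symm
    rw [h1, hone]
    refine Matrix.PosDef.add_posSemidef ?_ ?_
    · simpa using Matrix.PosDef.one
    · exact Matrix.posSemidef_sum _ fun x _ => Matrix.posSemidef_conjTranspose_mul_self _
  have hu : IsUnit H.det := (Matrix.isUnit_iff_isUnit_det _).1 hpd.isUnit
  have hgg : M g * M g⁻¹ = 1 := by rw [← hmul, mul_inv_cancel, hone]
  have key : (M g).conjTranspose * H = H * M g⁻¹ := by
    calc (M g).conjTranspose * H = (M g).conjTranspose * H * (M g * M g⁻¹) := by rw [hgg, mul_one]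
      _ = _ := by rw [← Matrix.mul_assoc, hinv]
  have : M g⁻¹ = H⁻¹ * ((M g).conjTranspose * H) := by
    rw [key, ← Matrix.mul_assoc, Matrix.nonsing_inv_mul _ hu, one_mul]
  rw [htr, htr, this, Matrix.trace_mul_comm, Matrix.mul_assoc, Matrix.mul_nonsing_inv _ hu, mul_one,
    Matrix.trace_conjTranspose]

lemma finrank_inter {G : Type} [Group G] [Fintype G] (V : FDRep ℂ G) (h : Simple V) :
    finrank ℂ (Representation.IntertwiningMap (V.ρ : Representation ℂ G V) V.ρ) = 1 := by
  have := invertibleOfNonzero (NeZero.ne (Nat.card G : ℂ))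
  have h1 := (FDRep.simple_iff_char_is_norm_one V).1 h
  have h2 := Representation.card_inv_mul_sum_char_mul_char_eq_finrank
    (V.ρ : Representation ℂ G V) V.ρ
  have h3 : ∑ g : G, Representation.character (V.ρ : Representation ℂ G V) g *
    Representation.character (V.ρ : Representation ℂ G V) g⁻¹ = Nat.card G := h1
  rw [h3, inv_mul_cancel_of_invertible] at h2
  exact_mod_cast h2.symm

lemma simple_of {G V : Type} [Group G] [Fintype G] [AddCommGroup V] [Module ℂ V]
    [FiniteDimensional ℂ V] (ρ : Representation ℂ G V) [ρ.IsIrreducible] :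
    Simple (FDRep.of ρ) := by
  have := invertibleOfNonzero (NeZero.ne (Nat.card G : ℂ))
  have h2 := Representation.card_inv_mul_sum_char_mul_char_eq_finrank ρ ρ
  rw [Representation.IsIrreducible.finrank_intertwiningMap_self, Nat.cast_one,
    inv_mul_eq_one₀ (NeZero.ne _)] at h2
  exact (FDRep.simple_iff_char_is_norm_one _).2 h2.symm

lemma central_scalar {G : Type} [Group G] [Fintype G] (V : FDRep ℂ G) (h : Simple V)
    (z : G) (hz : z ∈ Subgroup.center G) : ∃ c : ℂ, V.ρ z = c • (1 : V →ₗ[ℂ] V) := by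
  let ρ : Representation ℂ G V := V.ρ
  have h1 := finrank_inter V h
  have hne : (Representation.IntertwiningMap.id ρ) ≠ 0 := by
    intro h0
    have hz : ∀ v : V, v = 0 := fun v => by
      have := congrArg (fun f : Representation.IntertwiningMap ρ ρ => f v) h0
      simpa using this
    have hs : Subsingleton (Representation.IntertwiningMap ρ ρ) := ⟨fun f g => by
      ext v; rw [hz v]; simp⟩
    have := finrank_zero_of_subsingleton (R := ℂ) (M := Representation.IntertwiningMap ρ ρ)
    exact absurd (h1.symm.trans this) one_ne_zero
  obtain ⟨c, hc⟩ := (finrank_eq_one_iff_of_nonzero' _ hne).1 h1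
    (Representation.IntertwiningMap.centralMul ρ z hz)
  refine ⟨c, ?_⟩
  have := congrArg (fun f : Representation.IntertwiningMap ρ ρ => f.toLinearMap) hc
  exact this.symm

lemma exists_irred_aux {G : Type} [Group G] [Fintype G] (N : Subgroup G) (g : G) (n : ℕ) :
    ∀ (V : Type) [AddCommGroup V] [Module ℂ V] [FiniteDimensional ℂ V]
      (ρ : Representation ℂ G V), finrank ℂ V = n → (∀ x ∈ N, ρ x = 1) → ρ g ≠ 1 →
    ∃ W : FDRep ℂ G, Simple W ∧ (∀ x ∈ N, W.ρ x = 1) ∧ W.ρ g ≠ 1 := by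
  induction n using Nat.strong_induction_on with
  | _ n ih =>
  intro V _ _ _ ρ hn hN hg
  by_cases hirr : ρ.IsIrreducible
  · exact ⟨FDRep.of ρ, simple_of ρ, hN, hg⟩
  have hnt : Nontrivial (Subrepresentation ρ) := by
    refine ⟨⊥, ⊤, fun h => hg ?_⟩
    ext v
    have hv : v ∈ (⊥ : Subrepresentation ρ) := by rw [h]; trivial
    have hv : v = 0 := hv
    simp [hv]
  obtain ⟨W, hW0, hW1⟩ : ∃ W : Subrepresentation ρ, W ≠ ⊥ ∧ W ≠ ⊤ := by
    by_contra hcon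
    push Not at hcon
    exact hirr ⟨fun a => or_iff_not_imp_left.2 (hcon a)⟩
  have hss : Representation.IsSemisimpleRepresentation ρ := inferInstance
  obtain ⟨W', hc⟩ := exists_isCompl W
  have hW'1 : W' ≠ ⊤ := fun h => hW0 (by rw [h] at hc; exact eq_bot_of_isCompl_top hc)
  have step : ∀ U : Subrepresentation ρ, U ≠ ⊤ → (∃ v ∈ U, ρ g v ≠ v) →
      ∃ W : FDRep ℂ G, Simple W ∧ (∀ x ∈ N, W.ρ x = 1) ∧ W.ρ g ≠ 1 := by
    rintro U hU ⟨v, hv, hgv⟩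
    refine ih (finrank ℂ U.toSubmodule) ?_ U.toSubmodule U.toRepresentation rfl ?_ ?_
    · rw [← hn]
      refine Submodule.finrank_lt fun h => hU ?_
      exact Subrepresentation.toSubmodule_injective h
    · intro x hx
      ext w
      change ρ x w = w
      rw [hN x hx]; rfl
    · intro h
      apply hgv
      have := congrArg (fun f : U.toSubmodule →ₗ[ℂ] U.toSubmodule => ((f ⟨v, hv⟩ : U.toSubmodule) : V)) h
      exact this
  by_cases h1 : ∃ v ∈ W, ρ g v ≠ v
  · exact step W hW1 h1
  by_cases h2 : ∃ v ∈ W', ρ g v ≠ v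
  · exact step W' hW'1 h2
  push Not at h1 h2
  exfalso
  apply hg
  ext v
  have hv : v ∈ (W ⊔ W').toSubmodule := by rw [hc.sup_eq_top]; trivial
  rw [Subrepresentation.toSubmodule_sup] at hv
  obtain ⟨a, ha, b, hb, rfl⟩ := Submodule.mem_sup.1 hv
  rw [map_add, h1 a ha, h2 b hb]; rfl

lemma exists_irred {G : Type} [Group G] [Fintype G] (N : Subgroup G) [N.Normal] (g : G)
    (hg : g ∉ N) : ∃ W : FDRep ℂ G, Simple W ∧ (∀ x ∈ N, W.ρ x = 1) ∧ W.ρ g ≠ 1 := by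
  have : FiniteDimensional ℂ (MonoidAlgebra ℂ (G ⧸ N)) :=
    Module.Finite.equiv (MonoidAlgebra.coeffLinearEquiv (S := ℂ) (M := G ⧸ N) ℂ).symm
  refine exists_irred_aux N g _ _ (Representation.ofMulAction ℂ G (G ⧸ N)) rfl ?_ ?_
  · intro x hx
    have hx' : ∀ q : G ⧸ N, x • q = q := by
      intro q
      induction q using QuotientGroup.induction_on with
      | H y =>
        change ((x * y : G) : G ⧸ N) = y
        rw [QuotientGroup.mk_mul, (QuotientGroup.eq_one_iff x).2 hx, one_mul]
    rw [Representation.ofMulAction_def]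
    ext q
    simp [hx']
  · intro h
    have := congrArg (fun f => f (MonoidAlgebra.single ((1 : G) : G ⧸ N) (1 : ℂ))) h
    simp only [Representation.ofMulAction_single, Module.End.one_apply] at this
    have h2 := congrArg (fun f => f.coeff ((1 : G) : G ⧸ N)) this
    simp only [MonoidAlgebra.coeff_single] at h2
    apply hg
    rw [← QuotientGroup.eq_one_iff]
    by_contra h3
    have : g • ((1 : G) : G ⧸ N) ≠ ((1 : G) : G ⧸ N) := by
      change ((g * 1 : G) : G ⧸ N) ≠ _
      simpa using h3
    rw [Finsupp.single_eq_of_ne this.symm, Finsupp.single_eq_same] at h2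
    exact zero_ne_one h2

lemma comm_of_finrank_one {V : Type} [AddCommGroup V] [Module ℂ V] (h : finrank ℂ V = 1)
    (f g : V →ₗ[ℂ] V) : f * g = g * f := by
  obtain ⟨v, hv, hs⟩ := finrank_eq_one_iff'.1 h
  obtain ⟨a, ha⟩ := hs (f v)
  obtain ⟨b, hb⟩ := hs (g v)
  ext w
  obtain ⟨c, rfl⟩ := hs w
  simp [← ha, ← hb, smul_comm a b]

lemma char_central_mul {G : Type} [Group G] [Fintype G] (V : FDRep ℂ G) (h : Simple V)
    (z : G) (hz : z ∈ Subgroup.center G) :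
    V.character z * V.character z⁻¹ = (finrank ℂ V : ℂ) ^ 2 := by
  obtain ⟨c, hc⟩ := central_scalar V h z hz
  obtain ⟨d, hd⟩ := central_scalar V h z⁻¹ (inv_mem hz)
  have h1 : V.ρ z * V.ρ z⁻¹ = 1 := by rw [← map_mul, mul_inv_cancel, map_one]
  rw [hc, hd, smul_mul_smul_comm, mul_one] at h1
  have h2 := congrArg (LinearMap.trace ℂ V) h1
  simp only [map_smul, LinearMap.trace_one, smul_eq_mul] at h2
  simp only [FDRep.character, hc, hd, map_smul, LinearMap.trace_one, smul_eq_mul]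
  linear_combination (finrank ℂ V : ℂ) * h2

lemma vanish_of_nontrivial {G : Type} [Group G] [Fintype G] (hcp : IsCaminaPairCenter G)
    (V : FDRep ℂ G) (h : Simple V) (z : G) (hz : z ∈ Subgroup.center G) (hz1 : V.ρ z ≠ 1)
    (g : G) (hg : g ∉ Subgroup.center G) : V.character g = 0 := by
  obtain ⟨c, hc⟩ := central_scalar V h z hz
  obtain ⟨x, hx⟩ := isConj_iff.1 (hcp.2.2 g hg z hz)
  have h1 : V.character (g * z) = V.character g := by rw [← hx, FDRep.char_conj]
  have h2 : V.character (g * z) = c * V.character g := by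
    simp only [FDRep.character, map_mul, hc]
    rw [mul_smul_comm, mul_one, map_smul, smul_eq_mul]
  have hc1 : c ≠ 1 := by rintro rfl; exact hz1 (by rw [hc, one_smul])
  have h3 : (c - 1) * V.character g = 0 := by linear_combination h1 - h2
  exact (mul_eq_zero.1 h3).resolve_left (sub_ne_zero.2 hc1)

open scoped Classical in
lemma sum_split {G : Type} [Group G] [Fintype G] (V : FDRep ℂ G) (h : Simple V) :
    (Nat.card G : ℂ) = Nat.card (Subgroup.center G) * (finrank ℂ V : ℂ) ^ 2 +
      ∑ g ∈ Finset.univ.filter (fun g => g ∉ Subgroup.center G),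
        V.character g * V.character g⁻¹ := by
  rw [← (FDRep.simple_iff_char_is_norm_one V).1 h,
    ← Finset.sum_filter_add_sum_filter_not Finset.univ (fun g => g ∈ Subgroup.center G)]
  congr 1
  rw [Finset.sum_congr rfl (fun z hz => char_central_mul V h z (Finset.mem_filter.1 hz).2),
    Finset.sum_const, nsmul_eq_mul]
  congr 2
  rw [Nat.card_eq_fintype_card, Fintype.card_subtype]

lemma card_of_vanish {G : Type} [Group G] [Fintype G] (V : FDRep ℂ G) (h : Simple V)
    (hv : ∀ g ∉ Subgroup.center G, V.character g = 0) :
    (Nat.card G : ℂ) = Nat.card (Subgroup.center G) * (finrank ℂ V : ℂ) ^ 2 := by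
  classical
  rw [sum_split V h, Finset.sum_eq_zero, add_zero]
  intro g hg
  rw [hv g (Finset.mem_filter.1 hg).2, zero_mul]

lemma vanish_of_card {G : Type} [Group G] [Fintype G] (V : FDRep ℂ G) (h : Simple V)
    (hv : (Nat.card G : ℂ) = Nat.card (Subgroup.center G) * (finrank ℂ V : ℂ) ^ 2) :
    ∀ g ∉ Subgroup.center G, V.character g = 0 := by
  classical
  have h1 := sum_split V h
  have h2 : ∀ g, V.character g * V.character g⁻¹ = ((Complex.normSq (V.character g) : ℝ) : ℂ) :=
    fun g => by
      have : V.character g⁻¹ = star (V.character g) :=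
        char_inv_eq_star (V.ρ : Representation ℂ G V) g
      rw [this]; exact Complex.mul_conj _
  rw [← hv, left_eq_add, Finset.sum_congr rfl (fun g _ => h2 g)] at h1
  norm_cast at h1
  rw [Finset.sum_eq_zero_iff_of_nonneg (fun g _ => Complex.normSq_nonneg _)] at h1
  intro g hg
  exact Complex.normSq_eq_zero.1 (h1 g (by simpa using hg))

lemma trivial_simple (G : Type) [Group G] [Fintype G] :
    Simple (FDRep.of (Representation.trivial ℂ G ℂ)) := by
  rw [FDRep.simple_iff_char_is_norm_one]
  have : ∀ g, (FDRep.of (Representation.trivial ℂ G ℂ)).character g = 1 := fun g => by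
    change LinearMap.trace ℂ ℂ (1 : ℂ →ₗ[ℂ] ℂ) = 1
    rw [LinearMap.trace_one]; simp
  simp [this]

lemma finrank_one_of_trivial {G : Type} [Group G] [Fintype G] (V : FDRep ℂ G) (h : Simple V)
    (hv : ∀ g ∉ Subgroup.center G, V.character g = 0)
    (hZ : ∀ z ∈ Subgroup.center G, V.ρ z = 1) : finrank ℂ V = 1 := by
  classical
  have := invertibleOfNonzero (NeZero.ne (Nat.card G : ℂ))
  let T := FDRep.of (Representation.trivial ℂ G ℂ)
  have hT : ∀ g, T.character g = 1 := fun g => by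
    change LinearMap.trace ℂ ℂ (1 : ℂ →ₗ[ℂ] ℂ) = 1
    rw [LinearMap.trace_one]; simp
  have hTs : Simple T := trivial_simple G
  have h1 := FDRep.char_orthonormal V T
  by_cases hi : Nonempty (V ≅ T)
  · obtain ⟨i⟩ := hi
    have := congrFun (FDRep.char_iso i) 1
    rw [hT, FDRep.char_one] at this
    exact_mod_cast this
  exfalso
  rw [if_neg hi, mul_eq_zero, or_iff_right (inv_ne_zero (NeZero.ne _))] at h1
  simp only [hT, mul_one] at h1
  rw [← Finset.sum_filter_add_sum_filter_not Finset.univ (fun g => g ∈ Subgroup.center G),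
    Finset.sum_eq_zero (s := Finset.univ.filter (fun g => g ∉ Subgroup.center G))
      (fun g hg => hv g (Finset.mem_filter.1 hg).2), add_zero,
    Finset.sum_congr rfl (g := fun _ => (finrank ℂ V : ℂ)) (fun z hz => by
      rw [FDRep.character, hZ z (Finset.mem_filter.1 hz).2, LinearMap.trace_one]),
    Finset.sum_const, nsmul_eq_mul, mul_eq_zero] at h1
  rcases h1 with h1 | h1
  · have h2 : (1 : G) ∈ Finset.univ.filter (fun g : G => g ∈ Subgroup.center G) := by
      simp [one_mem]
    rw [Nat.cast_eq_zero, Finset.card_eq_zero] at h1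
    rw [h1] at h2
    simp at h2
  · have hc := card_of_vanish V h hv
    rw [h1] at hc
    exact NeZero.ne (Nat.card G : ℂ) (by simpa using hc)

end CaminaAux

open CaminaAux in
theorem stmt_12 {p : ℕ} (hp : p.Prime)
    {G : Type} [Group G] [Fintype G] (hpG : IsPGroup p G)
    (hcp : IsCaminaPairCenter G)
    (hcd : Set.ncard {n : ℕ | ∃ χ : G → ℂ, IsIrredCharacter χ ∧ χ 1 = (n : ℂ)} = 2) :
    (∀ χ : G → ℂ, IsIrredCharacter χ → χ 1 ≠ 1 →
      ∀ g ∉ Subgroup.center G, χ g = 0) ∧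
    commutator G = Subgroup.center G := by
  obtain ⟨g₀, -, hg₀⟩ := SetLike.exists_of_lt hcp.2.1
  have hle : Subgroup.center G ≤ commutator G := by
    intro z hz
    obtain ⟨x, hx⟩ := isConj_iff.1 (hcp.2.2 g₀ hg₀ z hz)
    have : z = g₀⁻¹ * x * (g₀⁻¹)⁻¹ * x⁻¹ := by
      rw [inv_inv, mul_assoc, mul_assoc, ← mul_assoc x, hx,
        inv_mul_cancel_left]
    rw [this, ← commutatorElement_def]
    exact Subgroup.commutator_mem_commutator (Subgroup.mem_top _) (Subgroup.mem_top _)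
  have hlin : ∀ V : FDRep ℂ G, finrank ℂ V = 1 → ∀ x ∈ commutator G, V.ρ x = 1 := by
    intro V hV x hx
    have : commutator G ≤ (MonoidHom.toHomUnits V.ρ).ker := by
      rw [commutator_def, Subgroup.commutator_le]
      intro a _ b _
      rw [MonoidHom.mem_ker, map_commutatorElement, commutatorElement_eq_one_iff_mul_comm]
      ext1
      exact comm_of_finrank_one hV _ _
    have h2 := congrArg Units.val (MonoidHom.mem_ker.1 (this hx))
    exact h2
  obtain ⟨z, hz, hz1⟩ := SetLike.exists_of_lt hcp.1
  obtain ⟨V₀, hV₀, -, hV₀z⟩ := exists_irred (⊥ : Subgroup G) z hz1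
  have hm : finrank ℂ V₀ ≠ 1 := fun h => hV₀z (hlin V₀ h z (hle hz))
  have hvan := vanish_of_nontrivial hcp V₀ hV₀ z hz hV₀z
  have hcard := card_of_vanish V₀ hV₀ hvan
  have hdeg : ∀ V : FDRep ℂ G, Simple V → finrank ℂ V ≠ 1 → finrank ℂ V = finrank ℂ V₀ := by
    intro V hV hV1
    obtain ⟨a, b, hab, hS⟩ := Set.ncard_eq_two.1 hcd
    have mem : ∀ W : FDRep ℂ G, Simple W → finrank ℂ W ∈ ({a, b} : Set ℕ) := fun W hW => by
      rw [← hS]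
      exact ⟨W.character, ⟨W, hW, rfl⟩, FDRep.char_one W⟩
    have e1 := mem V hV
    have e2 := mem V₀ hV₀
    have e3 := mem _ (trivial_simple G)
    have e4 : finrank ℂ (FDRep.of (Representation.trivial ℂ G ℂ)) = 1 := finrank_self ℂ
    rw [e4] at e3
    simp only [Set.mem_insert_iff, Set.mem_singleton_iff] at e1 e2 e3
    omega
  have hVZ : ∀ V : FDRep ℂ G, Simple V → finrank ℂ V ≠ 1 →
      ∀ g ∉ Subgroup.center G, V.character g = 0 := fun V hV hV1 =>
    vanish_of_card V hV (by rw [hdeg V hV hV1]; exact hcard)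
  refine ⟨?_, le_antisymm ?_ hle⟩
  · rintro _ ⟨V, hV, rfl⟩ h1
    refine hVZ V hV fun h => h1 ?_
    rw [FDRep.char_one, h, Nat.cast_one]
  · intro x hx
    by_contra hxZ
    obtain ⟨V, hV, hVZ', hVx⟩ := exists_irred (Subgroup.center G) x hxZ
    have hV1 : finrank ℂ V ≠ 1 := fun h => hVx (hlin V h x hx)
    exact hV1 (finrank_one_of_trivial V hV (hVZ V hV hV1) hVZ')
end

section
/- Let p be an odd prime and let G and H be groups of order p^5, each satisfying: the center has order p; the pair (group, center) is a Camina pair; the quotient by the center is a VZ-group whose center is elementary abelian of order p² and whose commutator subgroup has order p (the hypotheses satisfied by the groups of order p^5 in the isoclinism families Φ7 and Φ8). Then ℚG ≅ ℚH as ℚ-algebras if and only if G/G' ≅ H/H' as groups. -/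
/-- A VZ-group: every nonlinear irreducible complex character vanishes off the center. -/
def IsVZGroup (G : Type) [Group G] : Prop :=
  ∀ χ : G → ℂ, IsIrredCharacter χ → χ 1 ≠ 1 → ∀ g ∉ Subgroup.center G, χ g = 0

/-- Coinduction of a linear character along an injective hom, as a matrix representation. -/
lemma aux_exists_rep {F : Type} [Field F] {Q : Type} [Group Q] [Finite Q] {S : Type} [Group S]
    (i : S →* Q) (hi : Function.Injective i) (μ : S →* Fˣ) (m : ℕ)
    (hm : Nat.card S * m = Nat.card Q) :
    ∃ ρ : Q →* Matrix (Fin m) (Fin m) F,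
      ∀ s, i s ∈ Subgroup.center Q → ρ (i s) = (μ s : F) • (1 : Matrix (Fin m) (Fin m) F) := by
  classical
  let σ : Representation F S F :=
    { toFun := fun s => (μ s : F) • LinearMap.id
      map_one' := by simp; rfl
      map_mul' := fun a b => by ext; simp [mul_comm] }
  have hσ : ∀ s (x : F), σ s x = (μ s : F) * x := fun s x => rfl
  obtain ⟨T, hT, -⟩ := Subgroup.exists_isComplement_right i.range (1 : Q)
  have hcard : Nat.card T = m := by
    have h1 := hT.card_mul_card
    have h2 : Nat.card i.range = Nat.card S :=
      (Nat.card_congr (MonoidHom.ofInjective hi).toEquiv).symm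
    have h3 : Nat.card (i.range : Set Q) = Nat.card S := h2
    rw [h3, ← hm] at h1
    have : 0 < Nat.card S := by
      rcases Nat.eq_zero_or_pos (Nat.card S) with h | h
      · rw [h, zero_mul] at hm
        exact absurd hm.symm Nat.card_pos.ne'
      · exact h
    exact Nat.eq_of_mul_eq_mul_left this h1
  have hex : ∀ g : Q, ∃ (s : S) (t : T), i s * t = g := by
    intro g
    obtain ⟨⟨⟨_, s, rfl⟩, t⟩, h⟩ := hT.2 g
    exact ⟨s, t, h⟩
  have huniq : ∀ (s s' : S) (t t' : T), i s * t = i s' * t' → s = s' ∧ t = t' := by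
    intro s s' t t' h
    have := @hT.1 (⟨i s, s, rfl⟩, t) (⟨i s', s', rfl⟩, t') h
    exact ⟨hi (congrArg (fun x => (x.1 : Q)) this), congrArg (fun x => x.2) this⟩
  choose a b hab using hex
  let V := Representation.coindV i σ
  let r : V →ₗ[F] (T → F) :=
    { toFun := fun f t => f.1 t
      map_add' := fun f g => rfl
      map_smul' := fun c f => rfl }
  have hr : Function.Bijective r := by
    constructor
    · intro f g hfg
      ext x
      rw [← hab x, f.2, g.2]
      have := congrFun hfg (b x)
      exact congrArg (σ (a x)) this
    · intro φ
      refine ⟨⟨fun x => (μ (a x) : F) * φ (b x), ?_⟩, ?_⟩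
      · intro s h
        have h1 := hab (i s * h)
        have h2 : i (s * a h) * (b h : Q) = i s * h := by rw [map_mul, mul_assoc, hab]
        obtain ⟨h3, h4⟩ := huniq _ _ _ _ (h1.trans h2.symm)
        rw [hσ]
        simp only [h3, h4, map_mul, Units.val_mul, mul_assoc]
      · funext t
        have h1 := hab (t : Q)
        have h2 : i 1 * (t : Q) = t := by simp
        obtain ⟨h3, h4⟩ := huniq _ _ _ _ (h1.trans h2.symm)
        change (μ (a t) : F) * φ (b t) = φ t
        rw [h3, h4]; simp
  have : Finite T := inferInstance
  let eT : T ≃ Fin m := Finite.equivFinOfCardEq hcard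
  let bas : Module.Basis (Fin m) F V :=
    Module.Basis.ofEquivFun ((LinearEquiv.ofBijective r hr).trans (LinearEquiv.funCongrLeft F F eT.symm))
  refine ⟨(LinearMap.toMatrixAlgEquiv bas : _ →* _).comp (Representation.coind i σ), ?_⟩
  intro s hs
  have : Representation.coind i σ (i s) = (μ s : F) • (1 : V →ₗ[F] V) := by
    ext f x
    change f.1 (x * i s) = (μ s : F) * f.1 x
    rw [Subgroup.mem_center_iff.1 hs x, f.2, hσ]
  change LinearMap.toMatrixAlgEquiv bas (Representation.coind i σ (i s)) = _
  rw [this, map_smul, map_one]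

lemma aux_trace_zeta {p : ℕ} [Fact p.Prime] {F : Type} [Field F] [Algebra ℚ F]
    [IsCyclotomicExtension {p} ℚ F] (z : F) (hz : IsPrimitiveRoot z p) :
    Algebra.trace ℚ F z = -1 := by
  have hp : p.Prime := Fact.out
  have hirr := Polynomial.cyclotomic.irreducible_rat hp.pos
  have : NeZero p := ⟨hp.ne_zero⟩
  let pb := hz.powerBasis ℚ
  have h := PowerBasis.trace_gen_eq_nextCoeff_minpoly pb
  have hg : pb.gen = z := hz.powerBasis_gen ℚ
  rw [hg, ← hz.minpoly_eq_cyclotomic_of_irreducible hirr] at h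
  rw [h, Polynomial.cyclotomic_prime]
  have h2 := hp.two_le
  have hd : (∑ i ∈ Finset.range p, (Polynomial.X : Polynomial ℚ) ^ i).natDegree = p - 1 := by
    rw [← Polynomial.cyclotomic_prime, Polynomial.natDegree_cyclotomic, Nat.totient_prime hp]
  rw [Polynomial.nextCoeff_of_natDegree_pos (by omega), hd]
  simp [Polynomial.finsetSum_coeff, Polynomial.coeff_X_pow]
  omega

/-- A rational algebra map to matrices over the `p`-th cyclotomic field, with trace character. -/
lemma aux_block {p : ℕ} [Fact p.Prime] (F : Type) [Field F] [Algebra ℚ F]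
    [IsCyclotomicExtension {p} ℚ F] {Q : Type} [Group Q] [Finite Q] (Z K : Subgroup Q) (m : ℕ)
    (hZc : Z ≤ Subgroup.center Q) (hZ : Nat.card Z = p) (hKZ : Disjoint K Z)
    (hm : Nat.card K * p * m = Nat.card Q)
    (hconj : ∀ g, g ∉ Z → ∃ z ∈ Z, z ≠ 1 ∧ IsConj g (g * z)) :
    ∃ ρ : Q →* Matrix (Fin m) (Fin m) F,
      (∀ g, g ∉ Z → Algebra.trace ℚ F (Matrix.trace (ρ g)) = 0) ∧
      (∀ g, g ∈ Z → g ≠ 1 → Algebra.trace ℚ F (Matrix.trace (ρ g)) = -m) ∧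
      Algebra.trace ℚ F (Matrix.trace (ρ 1)) = m * (p - 1) := by
  have hp : p.Prime := Fact.out
  have : NeZero p := ⟨hp.ne_zero⟩
  have hζ := IsCyclotomicExtension.zeta_spec p ℚ F
  set ζ := IsCyclotomicExtension.zeta p ℚ F
  -- a faithful character of `Z`
  have hcyc : IsCyclic Z := isCyclic_of_prime_card hZ
  obtain ⟨l, hl⟩ : ∃ l : Z →* Fˣ, Function.Injective l := by
    let u : Fˣ := hζ.toRootsOfUnity
    have hu : orderOf u = p := by
      rw [← orderOf_units]; exact hζ.eq_orderOf.symm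
    have e : Z ≃* Subgroup.zpowers u := mulEquivOfPrimeCardEq hZ (by rw [Nat.card_zpowers, hu])
    exact ⟨(Subgroup.zpowers u).subtype.comp e.toMonoidHom,
      (Subgroup.subtype_injective _).comp e.injective⟩
  have hcomm : ∀ (k : K) (z : Z), Commute (K.subtype k) (Z.subtype z) :=
    fun k z => (Subgroup.mem_center_iff.1 (hZc z.2) k)
  let i : K × Z →* Q := MonoidHom.noncommCoprod K.subtype Z.subtype hcomm
  have hi : Function.Injective i := by
    rw [injective_iff_map_eq_one]
    rintro ⟨k, z⟩ h
    have h1 : (k : Q) * z = 1 := h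
    have h2 : (k : Q) = (z : Q)⁻¹ := eq_inv_of_mul_eq_one_left h1
    have h3 : (k : Q) ∈ Z := by rw [h2]; exact Z.inv_mem z.2
    have h4 : (k : Q) = 1 := by
      have := (Subgroup.disjoint_def.1 hKZ) k.2 h3
      exact this
    have h5 : (z : Q) = 1 := by rw [h4, one_mul] at h1; exact h1
    exact Prod.ext (Subtype.ext h4) (Subtype.ext h5)
  obtain ⟨ρ, hρ⟩ := aux_exists_rep (F := F) i hi (l.comp (MonoidHom.snd K Z)) m
    (by rw [Nat.card_prod, hZ, hm])
  have hρz : ∀ z : Z, ρ z = (l z : F) • (1 : Matrix (Fin m) (Fin m) F) := by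
    intro z
    have h1 : i (1, z) = z := by simp [i]
    have := hρ (1, z) (by rw [h1]; exact hZc z.2)
    rwa [h1] at this
  refine ⟨ρ, ?_, ?_, ?_⟩
  · intro g hg
    obtain ⟨z, hz, hz1, hc⟩ := hconj g hg
    obtain ⟨c, hc⟩ := isConj_iff.1 hc
    have h1 : Matrix.trace (ρ (g * z)) = Matrix.trace (ρ g) := by
      rw [← hc, map_mul, Matrix.trace_mul_comm, ← map_mul]
      congr 2
      group
    have h2 : Matrix.trace (ρ (g * z)) = (l ⟨z, hz⟩ : F) * Matrix.trace (ρ g) := by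
      rw [map_mul, hρz ⟨z, hz⟩]; simp
    have h3 : (l ⟨z, hz⟩ : F) ≠ 1 := by
      intro h
      apply hz1
      have : l ⟨z, hz⟩ = l 1 := by rw [map_one]; exact Units.ext h
      simpa using congrArg Subtype.val (hl this)
    have h4 : ((l ⟨z, hz⟩ : F) - 1) * Matrix.trace (ρ g) = 0 := by
      rw [sub_mul, one_mul, ← h2, h1, sub_self]
    rcases mul_eq_zero.1 h4 with h | h
    · exact absurd (sub_eq_zero.1 h) h3
    · rw [h, map_zero]
  · intro g hg hg1
    have h1 : IsPrimitiveRoot (l ⟨g, hg⟩ : F) p := by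
      have h2 : orderOf (⟨g, hg⟩ : Z) = p := by
        apply orderOf_eq_prime
        · rw [← hZ]; exact pow_card_eq_one'
        · intro h; exact hg1 (congrArg Subtype.val h)
      rw [← orderOf_injective l hl, ← orderOf_units] at h2
      have h3 := IsPrimitiveRoot.orderOf (l ⟨g, hg⟩ : F)
      rwa [h2] at h3
    have h2 : Matrix.trace (ρ g) = (m : ℚ) • (l ⟨g, hg⟩ : F) := by
      rw [hρz ⟨g, hg⟩, Matrix.trace_smul, Matrix.trace_one, Nat.cast_smul_eq_nsmul, nsmul_eq_mul]; simp [mul_comm]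
    rw [h2, map_smul, aux_trace_zeta _ h1]; simp
  · have h2 : Matrix.trace (ρ 1) = algebraMap ℚ F m := by
      rw [map_one]; simp
    rw [h2, Algebra.trace_algebraMap, IsCyclotomicExtension.finrank F (Polynomial.cyclotomic.irreducible_rat hp.pos), Nat.totient_prime hp]
    rw [nsmul_eq_mul, Nat.cast_sub hp.one_le]; push_cast; ring
lemma aux_class_two_pow {D : Type} [Group D] (x y c : D) (hc : c ∈ Subgroup.center D)
    (h : y * x = c * x * y) (n : ℕ) : (x * y) ^ n = c ^ (n.choose 2) * x ^ n * y ^ n := by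
  have hcc : ∀ k : ℕ, ∀ g, g * c ^ k = c ^ k * g := fun k g =>
    Subgroup.mem_center_iff.1 (Subgroup.pow_mem _ hc k) g
  have h1 : ∀ n : ℕ, y ^ n * x = c ^ n * x * y ^ n := by
    intro n
    induction n with
    | zero => simp
    | succ n ih =>
      calc y ^ (n + 1) * x = y ^ n * (y * x) := by rw [pow_succ, mul_assoc]
        _ = y ^ n * c ^ 1 * x * y := by rw [h, pow_one]; simp only [mul_assoc]
        _ = c ^ 1 * (y ^ n * x) * y := by rw [hcc]; simp only [mul_assoc]
        _ = c ^ (n + 1) * x * y ^ (n + 1) := by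
          rw [ih, pow_succ y, pow_add, ← pow_mul_comm c]; simp only [mul_assoc, pow_one]
  induction n with
  | zero => simp
  | succ n ih =>
    have h2 : (n + 1).choose 2 = n.choose 2 + n := by
      rw [Nat.choose_succ_succ' n 1, Nat.choose_one_right, add_comm]
    calc (x * y) ^ (n + 1) = c ^ (n.choose 2) * x ^ n * (y ^ n * x) * y := by
          rw [pow_succ, ih]; simp only [mul_assoc]
      _ = c ^ (n.choose 2) * (x ^ n * c ^ n) * x * y ^ n * y := by
          rw [h1]; simp only [mul_assoc]
      _ = _ := by rw [hcc, h2, pow_add, pow_succ x, pow_succ y]; simp only [mul_assoc]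

lemma aux_pow_hom {p : ℕ} (hp : p.Prime) (hodd : Odd p) {D : Type} [Group D]
    (hD : Nat.card D = p ^ 3) (x y : D) : (x * y) ^ p = x ^ p * y ^ p := by
  have : Fact p.Prime := ⟨hp⟩
  have : Finite D := Nat.finite_of_card_ne_zero (by rw [hD]; exact pow_ne_zero _ hp.ne_zero)
  by_cases hcom : ∀ a b : D, a * b = b * a
  · exact (Commute.mul_pow (hcom x y) p)
  have h3 : 2 < p := lt_of_le_of_ne hp.two_le (by rintro rfl; exact absurd hodd (by decide))
  obtain ⟨k, hk0, hk⟩ := IsPGroup.card_center_eq_prime_pow hD (by norm_num)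
  have hcq := Subgroup.card_eq_card_quotient_mul_card_subgroup (Subgroup.center D)
  rw [hD, hk] at hcq
  have hnc : ¬ IsCyclic (D ⧸ Subgroup.center D) := by
    intro hc
    exact hcom (fun a b => (MonoidHom.isMulCommutative_of_isCyclic_of_ker_le_center (QuotientGroup.mk' (Subgroup.center D))
      (by simp)).is_comm.comm a b)
  have hkk : k = 1 := by
    by_contra hne
    have hk3 : k ≤ 3 := by
      have : p ^ k ∣ p ^ 3 := ⟨_, by rw [hcq, mul_comm]⟩
      exact (Nat.pow_dvd_pow_iff_le_right hp.one_lt).1 this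
    have : k = 2 ∨ k = 3 := by omega
    rcases this with rfl | rfl
    · have h1 : Nat.card (D ⧸ Subgroup.center D) = p := by
        apply Nat.eq_of_mul_eq_mul_right (pow_pos hp.pos 2)
        rw [← hcq]; ring
      exact hnc (isCyclic_of_prime_card h1)
    · have h1 : Nat.card (D ⧸ Subgroup.center D) = 1 := by
        apply Nat.eq_of_mul_eq_mul_right (pow_pos hp.pos 3)
        rw [← hcq]; ring
      have := (Nat.card_eq_one_iff_unique.1 h1).1
      exact hnc inferInstance
  subst hkk
  have h1 : Nat.card (D ⧸ Subgroup.center D) = p ^ 2 := by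
    apply Nat.eq_of_mul_eq_mul_right (pow_pos hp.pos 1)
    rw [← hcq]; ring
  have hqc := (IsPGroup.isMulCommutative_of_card_eq_prime_sq h1).is_comm.comm
  set c := y * x * y⁻¹ * x⁻¹ with hc
  have hcm : c ∈ Subgroup.center D := by
    rw [← QuotientGroup.eq_one_iff]
    have := hqc (y : D ⧸ Subgroup.center D) x
    rw [hc]
    change (y : D ⧸ Subgroup.center D) * x * (y : D ⧸ Subgroup.center D)⁻¹ *
      (x : D ⧸ Subgroup.center D)⁻¹ = 1
    rw [this]; group
  have hcp : c ^ p = 1 := by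
    have h2 : (⟨c, hcm⟩ : Subgroup.center D) ^ p = 1 := by
      rw [pow_one] at hk
      rw [← hk]; exact pow_card_eq_one'
    simpa using congrArg Subtype.val h2
  rw [aux_class_two_pow x y c hcm (by rw [hc]; group) p]
  obtain ⟨t, ht⟩ := hp.dvd_choose_self (k := 2) (by norm_num) h3
  rw [ht, pow_mul, hcp, one_pow, one_mul]

lemma aux_p3 {p : ℕ} (hp : p.Prime) (hodd : Odd p) {D : Type} [Group D]
    (hD : Nat.card D = p ^ 3) (hnc : ¬ IsCyclic D) (Z : Subgroup D) (hZ : Nat.card Z ≤ p) :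
    ∃ y, y ∉ Z ∧ y ^ p = 1 := by
  have : Fact p.Prime := ⟨hp⟩
  have : Finite D := Nat.finite_of_card_ne_zero (by rw [hD]; exact pow_ne_zero _ hp.ne_zero)
  let f : D →* D := { toFun := fun x => x ^ p, map_one' := one_pow p, map_mul' := aux_pow_hom hp hodd hD }
  by_contra! hcon
  have hker : f.ker ≤ Z := by
    intro y hy
    by_contra h
    exact hcon y h hy
  have hran : f.range ≤ f.ker := by
    rintro _ ⟨x, rfl⟩
    change (x ^ p) ^ p = 1
    rw [← pow_mul, ← pow_two]
    have h1 : orderOf x ∣ p ^ 3 := hD ▸ orderOf_dvd_natCard x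
    obtain ⟨k, hk, hk'⟩ := (Nat.dvd_prime_pow hp).1 h1
    have : k ≠ 3 := by
      rintro rfl
      exact hnc (isCyclic_of_orderOf_eq_card x (by rw [hk', hD]))
    exact orderOf_dvd_iff_pow_eq_one.1 (hk' ▸ pow_dvd_pow p (by omega))
  have h1 : Nat.card f.ker ≤ p := (Subgroup.card_le_of_le hker).trans hZ
  have h2 : Nat.card f.range ≤ p := (Subgroup.card_le_of_le hran).trans h1
  have h3 : Nat.card f.ker * Nat.card f.range = p ^ 3 := by
    rw [← hD, ← Subgroup.index_ker, Subgroup.card_mul_index]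
  have h4 := Nat.mul_le_mul h1 h2
  rw [h3] at h4
  have h5 : p * p < p ^ 3 := by
    rw [← pow_two]; exact Nat.pow_lt_pow_right hp.one_lt (by norm_num)
  omega

lemma aux_card_comap {G : Type} [Group G] [Finite G] (N : Subgroup G) [N.Normal]
    (S : Subgroup (G ⧸ N)) :
    Nat.card (S.comap (QuotientGroup.mk' N)) = Nat.card S * Nat.card N := by
  have h1 := Subgroup.index_comap_of_surjective S (QuotientGroup.mk'_surjective N)
  have h2 := Subgroup.card_mul_index (S.comap (QuotientGroup.mk' N))
  have h3 := Subgroup.card_mul_index S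
  have h4 := Subgroup.card_eq_card_quotient_mul_card_subgroup N
  rw [h1] at h2
  have h5 : 0 < S.index := Nat.pos_of_ne_zero Subgroup.index_ne_zero_of_finite
  apply Nat.eq_of_mul_eq_mul_right h5
  rw [h2, h4, ← h3]; ring

lemma aux_normal_central {p : ℕ} [Fact p.Prime] {Q : Type} [Group Q] [Finite Q] (hQ : IsPGroup p Q)
    (N : Subgroup Q) [N.Normal] (hN : Nat.card N = p) : N ≤ Subgroup.center Q := by
  have hp : p.Prime := Fact.out
  have hQ' : IsPGroup p (ConjAct Q) := hQ.of_equiv ConjAct.toConjAct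
  obtain ⟨b, hb, hb1⟩ := hQ'.exists_fixed_point_of_prime_dvd_card_of_fixed_point N
    (by rw [hN]) (a := 1) (by intro g; simp)
  have hbc : (b : Q) ∈ Subgroup.center Q := by
    rw [Subgroup.mem_center_iff]
    intro g
    have h1 := congrArg Subtype.val (hb (ConjAct.toConjAct g))
    rw [ConjAct.Subgroup.val_conj_smul, ConjAct.toConjAct_smul] at h1
    exact mul_inv_eq_iff_eq_mul.1 h1
  intro x hx
  have h2 : (⟨x, hx⟩ : N) ∈ Subgroup.zpowers b := mem_zpowers_of_prime_card hN (Ne.symm hb1)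
  obtain ⟨k, hk⟩ := h2
  have h3 : x = (b : Q) ^ k := by simpa using (congrArg Subtype.val hk).symm
  rw [h3]
  exact Subgroup.zpow_mem _ hbc k

/-- The group-theoretic facts that are used, with `W` the second center. -/
structure AuxFacts (p : ℕ) (G : Type) [Group G] (W : Subgroup G) : Prop where
  cardG : Nat.card G = p ^ 5
  cardZ : Nat.card (Subgroup.center G) = p
  cardW : Nat.card W = p ^ 3
  cardC : Nat.card (commutator G) = p ^ 2
  ZC : Subgroup.center G ≤ commutator G
  CW : commutator G ≤ W
  Wcomm : ∀ w ∈ W, ∀ g, g * w * g⁻¹ * w⁻¹ ∈ Subgroup.center G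
  Wnot : ∀ w, w ∉ W → ∃ g, g * w * g⁻¹ * w⁻¹ ∉ Subgroup.center G
  Wpow : ∀ w ∈ W, w ^ p ∈ Subgroup.center G
  cam : ∀ g : G, g ∉ Subgroup.center G → ∀ z ∈ Subgroup.center G, IsConj g (g * z)

open scoped commutatorElement in
lemma aux_facts {p : ℕ} (hp : p.Prime) {G : Type} [Group G] [Finite G]
    (hcardG : Nat.card G = p ^ 5)
    (hZG : Nat.card (Subgroup.center G) = p)
    (hlt : Subgroup.center G < (⊤ : Subgroup G))
    (hcam : ∀ g : G, g ∉ Subgroup.center G → ∀ z ∈ Subgroup.center G, IsConj g (g * z))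
    (hZbarG : Nat.card (Subgroup.center (G ⧸ Subgroup.center G)) = p ^ 2)
    (hZbarexpG : ∀ z ∈ Subgroup.center (G ⧸ Subgroup.center G), z ^ p = 1)
    (hG'barG : Nat.card (commutator (G ⧸ Subgroup.center G)) = p) :
    AuxFacts p G ((Subgroup.center (G ⧸ Subgroup.center G)).comap
      (QuotientGroup.mk' (Subgroup.center G))) := by
  have : Fact p.Prime := ⟨hp⟩
  have hmap : (commutator G).map (QuotientGroup.mk' (Subgroup.center G)) =
      commutator (G ⧸ Subgroup.center G) := by
    rw [commutator_def, commutator_def, Subgroup.map_commutator,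
      Subgroup.map_top_of_surjective _ (QuotientGroup.mk'_surjective _)]
  have hZC : Subgroup.center G ≤ commutator G := by
    obtain ⟨g, -, hg⟩ := SetLike.exists_of_lt hlt
    intro z hz
    obtain ⟨c, hc⟩ := isConj_iff.1 (hcam g hg z hz)
    have : z = ⁅g⁻¹, c⁆ := by
      rw [commutatorElement_def]
      have : z = g⁻¹ * (c * g * c⁻¹) := by rw [hc]; group
      rw [this]; group
    rw [this]
    exact Subgroup.commutator_mem_commutator (Subgroup.mem_top _) (Subgroup.mem_top _)
  have hcomap : (commutator (G ⧸ Subgroup.center G)).comap (QuotientGroup.mk' (Subgroup.center G))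
      = commutator G := by
    rw [← hmap, Subgroup.comap_map_eq, QuotientGroup.ker_mk', sup_eq_left]
    exact hZC
  have hmem : ∀ w, w ∈ ((Subgroup.center (G ⧸ Subgroup.center G)).comap
      (QuotientGroup.mk' (Subgroup.center G))) ↔
      ∀ g, g * w * g⁻¹ * w⁻¹ ∈ Subgroup.center G := by
    intro w
    rw [Subgroup.mem_comap, Subgroup.mem_center_iff,
      (QuotientGroup.mk'_surjective (Subgroup.center G)).forall]
    refine forall_congr' fun g => ?_
    rw [← QuotientGroup.eq_one_iff (N := Subgroup.center G)]
    change ((g : G ⧸ Subgroup.center G) * w = w * g) ↔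
      (g : G ⧸ Subgroup.center G) * w * (g : G ⧸ Subgroup.center G)⁻¹ *
        (w : G ⧸ Subgroup.center G)⁻¹ = 1
    rw [mul_inv_eq_one, mul_inv_eq_iff_eq_mul]
  refine ⟨hcardG, hZG, ?_, ?_, hZC, ?_, ?_, ?_, ?_, hcam⟩
  · rw [aux_card_comap, hZbarG, hZG]; ring
  · rw [← hcomap, aux_card_comap, hG'barG, hZG]; ring
  · rw [← hcomap]
    apply Subgroup.comap_mono
    exact aux_normal_central ((IsPGroup.of_card hcardG).to_quotient _) _ hG'barG
  · intro w hw; exact (hmem w).1 hw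
  · intro w hw
    by_contra! h
    exact hw ((hmem w).2 h)
  · intro w hw
    rw [← QuotientGroup.eq_one_iff]
    exact hZbarexpG _ hw

open scoped commutatorElement in
lemma AuxFacts.exists_K {p : ℕ} (hp : p.Prime) (hodd : Odd p) {G : Type} [Group G] [Finite G]
    {W : Subgroup G} (h : AuxFacts p G W) :
    ∃ K : Subgroup G, Nat.card K = p ^ 2 ∧ Disjoint K (Subgroup.center G) := by
  have : Fact p.Prime := ⟨hp⟩
  have hp1 := hp.one_lt
  have hZW : Subgroup.center G ≤ W := h.ZC.trans h.CW
  -- an element of order `p` in `W`, not central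
  obtain ⟨n, hnW, hnZ, hnp⟩ : ∃ n ∈ W, n ∉ Subgroup.center G ∧ n ^ p = 1 := by
    have hnc : ¬ IsCyclic W := by
      intro hc
      obtain ⟨g, hg⟩ := hc.exists_generator
      have h1 : orderOf g = p ^ 3 := by
        rw [orderOf_eq_card_of_forall_mem_zpowers hg, h.cardW]
      have h2 : (g : G) ^ (p * p) = 1 := by
        rw [pow_mul]
        have h3 := pow_card_eq_one' (x := (⟨_, h.Wpow g g.2⟩ : Subgroup.center G))
        rw [h.cardZ] at h3
        simpa using congrArg Subtype.val h3
      have h3 : g ^ (p * p) = 1 := Subtype.ext (by simpa using h2)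
      have h4 := orderOf_dvd_of_pow_eq_one h3
      rw [h1, ← pow_two, Nat.pow_dvd_pow_iff_le_right hp1] at h4
      omega
    obtain ⟨y, hy, hyp⟩ := aux_p3 hp hodd h.cardW hnc ((Subgroup.center G).subgroupOf W) (by
      rw [Nat.card_congr (Subgroup.subgroupOfEquivOfLe hZW).toEquiv, h.cardZ])
    exact ⟨y, y.2, fun hh => hy (Subgroup.mem_subgroupOf.2 hh), by simpa using congrArg Subtype.val hyp⟩
  have hn1 : n ≠ 1 := fun hh => hnZ (hh ▸ Subgroup.one_mem _)
  have hno : orderOf n = p := orderOf_eq_prime hnp hn1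
  -- the centralizer of `n`
  let φ : G →* Subgroup.center G :=
    { toFun := fun g => ⟨g * n * g⁻¹ * n⁻¹, h.Wcomm n hnW g⟩
      map_one' := by simp
      map_mul' := fun a b => by
        apply Subtype.ext
        have h1 := Subgroup.mem_center_iff.1 (h.Wcomm n hnW b) a
        have h2 : a * b * n * (a * b)⁻¹ * n⁻¹ = (a * (b * n * b⁻¹ * n⁻¹)) * n * a⁻¹ * n⁻¹ := by group
        have h3 := Subgroup.mem_center_iff.1 (h.Wcomm n hnW b) (a * n * a⁻¹ * n⁻¹)
        change a * b * n * (a * b)⁻¹ * n⁻¹ = (a * n * a⁻¹ * n⁻¹) * (b * n * b⁻¹ * n⁻¹)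
        rw [h2, h1, h3]; simp only [mul_assoc] }
  set C := φ.ker with hC
  have hCmem : ∀ g, g ∈ C ↔ g * n = n * g := by
    intro g
    rw [hC, MonoidHom.mem_ker, Subtype.ext_iff]
    change g * n * g⁻¹ * n⁻¹ = 1 ↔ _
    rw [mul_inv_eq_one, mul_inv_eq_iff_eq_mul]
  have hCtop : ∃ g, g ∉ C := by
    by_contra! hh
    exact hnZ (Subgroup.mem_center_iff.2 fun g => (hCmem g).1 (hh g))
  have hCi : C.index = p := by
    have h1 : C.index ∣ p := by
      rw [hC, Subgroup.index_ker]; exact h.cardZ ▸ Subgroup.card_subgroup_dvd_card _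
    rcases (Nat.dvd_prime hp).1 h1 with h2 | h2
    · obtain ⟨g, hg⟩ := hCtop
      rw [Subgroup.index_eq_one] at h2
      exact absurd (h2 ▸ Subgroup.mem_top g) hg
    · exact h2
  have hCcard : Nat.card C = p ^ 4 := by
    have h1 := Subgroup.card_mul_index C
    rw [hCi, h.cardG] at h1
    exact Nat.eq_of_mul_eq_mul_right hp.pos (h1.trans (by ring))
  have hnC : n ∈ C := (hCmem n).2 rfl
  let n' : C := ⟨n, hnC⟩
  have hn'c : n' ∈ Subgroup.center C :=
    Subgroup.mem_center_iff.2 fun g => Subtype.ext ((hCmem g).1 g.2)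
  let N : Subgroup C := Subgroup.zpowers n'
  have hNc : N ≤ Subgroup.center C := Subgroup.zpowers_le.2 hn'c
  have : N.Normal := ⟨fun x hx g => by
    rw [Subgroup.mem_center_iff.1 (hNc hx) g]; simpa using hx⟩
  have hNcard : Nat.card N = p := by
    rw [Nat.card_zpowers]
    rw [← hno]
    exact Subgroup.orderOf_mk n hnC
  have hDcard : Nat.card (C ⧸ N) = p ^ 3 := by
    have h1 := Subgroup.card_eq_card_quotient_mul_card_subgroup N
    rw [hCcard, hNcard] at h1
    exact Nat.eq_of_mul_eq_mul_right hp.pos (h1.symm.trans (by ring))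
  have hnc : ¬ IsCyclic (C ⧸ N) := by
    intro hc
    have hcomm := (MonoidHom.isMulCommutative_of_isCyclic_of_ker_le_center (QuotientGroup.mk' N)
      (by rwa [QuotientGroup.ker_mk'])).is_comm.comm
    obtain ⟨g, hg⟩ := hCtop
    have hcent : ∀ c ∈ C, c * g = g * c → c ∈ Subgroup.center G := by
      intro c hc hcg
      have h1 : C ≤ Subgroup.centralizer {c} := by
        intro x hx
        rw [Subgroup.mem_centralizer_singleton_iff]
        exact congrArg Subtype.val (hcomm ⟨x, hx⟩ ⟨c, hc⟩)
      have h2 : g ∈ Subgroup.centralizer {c} := by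
        rw [Subgroup.mem_centralizer_singleton_iff]; exact hcg.symm
      have h3 : (Subgroup.centralizer {c}).index ∣ p := hCi ▸ Subgroup.index_dvd_of_le h1
      rcases (Nat.dvd_prime hp).1 h3 with h4 | h4
      · rw [Subgroup.index_eq_one] at h4
        refine Subgroup.mem_center_iff.2 fun x => ?_
        have : x ∈ Subgroup.centralizer {c} := h4 ▸ Subgroup.mem_top x
        rwa [Subgroup.mem_centralizer_singleton_iff] at this
      · exfalso
        have h5 : C = Subgroup.centralizer {c} := by
          apply Subgroup.eq_of_le_of_card_ge h1
          have h6 := Subgroup.card_mul_index (Subgroup.centralizer {c})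
          have h7 := Subgroup.card_mul_index C
          rw [h4, ← h7, hCi] at h6
          exact (Nat.eq_of_mul_eq_mul_right hp.pos h6).le
        exact hg (h5 ▸ h2)
    have hCn : C.Normal := MonoidHom.normal_ker φ
    let ψ : C →* G :=
      { toFun := fun c => c * (g * (c : G)⁻¹ * g⁻¹)
        map_one' := by simp
        map_mul' := fun a b => by
          have h1 : g * (a : G)⁻¹ * g⁻¹ ∈ C := hCn.conj_mem _ (C.inv_mem a.2) g
          have h2 : g * (b : G)⁻¹ * g⁻¹ ∈ C := hCn.conj_mem _ (C.inv_mem b.2) g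
          have h3 := congrArg Subtype.val (hcomm b ⟨_, h1⟩)
          have h4 := congrArg Subtype.val (hcomm ⟨_, h2⟩ ⟨_, h1⟩)
          simp only [Subgroup.coe_mul] at h3 h4
          calc ((a * b : C) : G) * (g * ((a * b : C) : G)⁻¹ * g⁻¹)
              = a * (b * ((g * (b : G)⁻¹ * g⁻¹) * (g * (a : G)⁻¹ * g⁻¹))) := by
                rw [Subgroup.coe_mul]; group
            _ = a * ((b * (g * (a : G)⁻¹ * g⁻¹)) * (g * (b : G)⁻¹ * g⁻¹)) := by
                rw [h4]; simp only [mul_assoc]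
            _ = _ := by rw [h3]; simp only [mul_assoc] }
    have hrange : ψ.range ≤ commutator G := by
      rintro _ ⟨c, rfl⟩
      have : ψ c = ⁅(c : G), g⁆ := by
        change (c : G) * (g * (c : G)⁻¹ * g⁻¹) = _
        rw [commutatorElement_def]; simp only [mul_assoc]
      rw [this]
      exact Subgroup.commutator_mem_commutator (Subgroup.mem_top _) (Subgroup.mem_top _)
    have hker : Nat.card ψ.ker ≤ p := by
      rw [← h.cardZ]
      refine Nat.card_le_card_of_injective
        (fun c : ψ.ker => (⟨(c : C), hcent _ (c : C).2 ?_⟩ : Subgroup.center G)) ?_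
      · have h1 : ((c : C) : G) * (g * ((c : C) : G)⁻¹ * g⁻¹) = 1 := c.2
        have h2 := eq_inv_of_mul_eq_one_left h1
        have h3 : ((c : C) : G) = g * ((c : C) : G) * g⁻¹ := h2.trans (by group)
        exact eq_mul_inv_iff_mul_eq.1 h3
      · intro a b hab
        exact Subtype.ext (Subtype.ext (Subtype.mk.inj hab))
    have h1 : Nat.card ψ.ker * Nat.card ψ.range = p ^ 4 := by
      rw [← hCcard, ← Subgroup.index_ker, Subgroup.card_mul_index]
    have h2 : Nat.card ψ.range ≤ p ^ 2 := h.cardC ▸ Subgroup.card_le_of_le hrange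
    have h3 := Nat.mul_le_mul hker h2
    rw [h1] at h3
    have h4 : p * p ^ 2 < p ^ 4 := by
      rw [← pow_succ']; exact Nat.pow_lt_pow_right hp1 (by norm_num)
    omega
  let ZC : Subgroup C := (Subgroup.center G).subgroupOf C
  have hZleC : Subgroup.center G ≤ C := fun z hz => (hCmem z).2
    (Subgroup.mem_center_iff.1 hz n).symm
  have hZCcard : Nat.card ZC = p := by
    rw [Nat.card_congr (Subgroup.subgroupOfEquivOfLe hZleC).toEquiv, h.cardZ]
  obtain ⟨y, hy, hyp⟩ := aux_p3 hp hodd hDcard hnc (ZC.map (QuotientGroup.mk' N))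
    (hZCcard ▸ Nat.card_le_card_of_surjective _ ((QuotientGroup.mk' N).subgroupMap_surjective ZC))
  have hy1 : y ≠ 1 := fun hh => hy (hh ▸ Subgroup.one_mem _)
  have hyo : orderOf y = p := orderOf_eq_prime hyp hy1
  let K' : Subgroup C := (Subgroup.zpowers y).comap (QuotientGroup.mk' N)
  have hK'card : Nat.card K' = p ^ 2 := by
    rw [aux_card_comap, Nat.card_zpowers, hyo, hNcard]; ring
  refine ⟨K'.map C.subtype, ?_, ?_⟩
  · rw [← hK'card]
    exact (Nat.card_congr (K'.equivMapOfInjective _ C.subtype_injective).toEquiv).symm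
  · rw [Subgroup.disjoint_def]
    rintro _ ⟨k, hk, rfl⟩ hkZ
    have hprime : ∀ {Q : Type} [Group Q] (x : Q) (S : Subgroup Q), orderOf x = p → x ∉ S →
        ∀ z ∈ Subgroup.zpowers x, z ∈ S → z = 1 := by
      intro Q _ x S hx hxS z hz hzS
      by_contra hz1
      apply hxS
      have hcd : Nat.card (Subgroup.zpowers x) = p := by rw [Nat.card_zpowers, hx]
      have h1 := mem_zpowers_of_prime_card (g := (⟨z, hz⟩ : Subgroup.zpowers x))
        (g' := ⟨x, Subgroup.mem_zpowers x⟩) hcd (fun hh => hz1 (congrArg Subtype.val hh))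
      obtain ⟨k, hk⟩ := h1
      have h2 : x = z ^ k := by simpa using (congrArg Subtype.val hk).symm
      rw [h2]; exact S.zpow_mem hzS k
    have h1 : QuotientGroup.mk' N k = 1 := hprime y (ZC.map (QuotientGroup.mk' N)) hyo hy _ hk
      ⟨k, hkZ, rfl⟩
    have h2 : k ∈ N := (QuotientGroup.eq_one_iff k).1 h1
    have h3 : (C.subtype k) ∈ Subgroup.zpowers n := by
      obtain ⟨j, hj⟩ := h2
      exact ⟨j, by simpa using congrArg Subtype.val hj⟩
    exact hprime n _ hno hnZ _ h3 hkZ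

open Classical in
/-- `aux_block` with an indicator-function formula. -/
lemma aux_block' {p : ℕ} [Fact p.Prime] (F : Type) [Field F] [Algebra ℚ F]
    [IsCyclotomicExtension {p} ℚ F] {Q : Type} [Group Q] [Finite Q] (Z K : Subgroup Q) (m : ℕ)
    (hZc : Z ≤ Subgroup.center Q) (hZ : Nat.card Z = p) (hKZ : Disjoint K Z)
    (hm : Nat.card K * p * m = Nat.card Q)
    (hconj : ∀ g, g ∉ Z → ∃ z ∈ Z, z ≠ 1 ∧ IsConj g (g * z)) :
    ∃ ρ : Q →* Matrix (Fin m) (Fin m) F, ∀ g,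
      Algebra.trace ℚ F (Matrix.trace (ρ g)) =
        m * (p * (if g = 1 then 1 else 0) - (if g ∈ Z then 1 else 0)) := by
  obtain ⟨ρ, h1, h2, h3⟩ := aux_block F Z K m hZc hZ hKZ hm hconj
  refine ⟨ρ, fun g => ?_⟩
  by_cases hg : g ∈ Z
  · by_cases hg1 : g = 1
    · subst hg1
      rw [h3]; simp [hg]
    · rw [h2 g hg hg1]; simp [hg, hg1]
  · have hg1 : g ≠ 1 := fun h => hg (h ▸ Z.one_mem)
    rw [h1 g hg]; simp [hg, hg1]

lemma AuxFacts.inter {p : ℕ} (hp : p.Prime) {G : Type} [Group G] [Finite G]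
    {W : Subgroup G} (h : AuxFacts p G W) {L : Subgroup G} (hZL : Subgroup.center G ≤ L)
    (hL : Nat.card L = p ^ 2) (hne : L ≠ commutator G) : L ⊓ commutator G = Subgroup.center G := by
  have hle : Subgroup.center G ≤ L ⊓ commutator G := le_inf hZL h.ZC
  refine (Subgroup.eq_of_le_of_card_ge hle ?_).symm
  have h1 : Nat.card (L ⊓ commutator G : Subgroup G) ∣ p ^ 2 :=
    hL ▸ Subgroup.card_dvd_of_le inf_le_left
  obtain ⟨k, hk, hk'⟩ := (Nat.dvd_prime_pow hp).1 h1
  have hk2 : k ≠ 2 := by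
    rintro rfl
    apply hne
    have h2 : L ⊓ commutator G = L := Subgroup.eq_of_le_of_card_ge inf_le_left (by rw [hk', hL])
    have h3 : L ⊓ commutator G = commutator G :=
      Subgroup.eq_of_le_of_card_ge inf_le_right (by rw [hk', h.cardC])
    exact h2.symm.trans h3
  rw [hk', h.cardZ]
  calc p ^ k ≤ p ^ 1 := Nat.pow_le_pow_right hp.pos (by omega)
    _ = p := pow_one p

open Classical in
lemma AuxFacts.block_L {p : ℕ} (hp : p.Prime) (hodd : Odd p) (F : Type) [Field F] [Algebra ℚ F]
    [IsCyclotomicExtension {p} ℚ F] {G : Type} [Group G] [Finite G]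
    {W : Subgroup G} (h : AuxFacts p G W) {L : Subgroup G} (hZL : Subgroup.center G ≤ L)
    (hLW : L ≤ W)
    (hL : Nat.card L = p ^ 2) (hne : L ≠ commutator G) :
    ∃ ρ : G →* Matrix (Fin p) (Fin p) F, ∀ g,
      Algebra.trace ℚ F (Matrix.trace (ρ g)) =
        p * (p * (if g ∈ L then 1 else 0) - (if g ∈ W then 1 else 0)) := by
  have : Fact p.Prime := ⟨hp⟩
  have hLn : L.Normal := ⟨fun x hx g => by
    have h1 := L.mul_mem (hZL (h.Wcomm x (hLW hx) g)) hx
    simpa using h1⟩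
  let π := QuotientGroup.mk' L
  have hπs : Function.Surjective π := QuotientGroup.mk'_surjective L
  have hπ1 : ∀ g, π g = 1 ↔ g ∈ L := fun g => QuotientGroup.eq_one_iff g
  let Z : Subgroup (G ⧸ L) := W.map π
  have hZcom : Z.comap π = W := by
    rw [Subgroup.comap_map_eq, QuotientGroup.ker_mk', sup_eq_left]; exact hLW
  have hZmem : ∀ g, π g ∈ Z ↔ g ∈ W := fun g => by rw [← Subgroup.mem_comap, hZcom]
  have hZ : Nat.card Z = p := by
    have h1 := aux_card_comap L Z
    change Nat.card (Z.comap π) = _ at h1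
    rw [hZcom, h.cardW, hL] at h1
    exact Nat.eq_of_mul_eq_mul_right (pow_pos hp.pos 2) (h1.symm.trans (by ring))
  have hQ : Nat.card (G ⧸ L) = p ^ 3 := by
    have h1 := Subgroup.card_eq_card_quotient_mul_card_subgroup L
    rw [h.cardG, hL] at h1
    exact Nat.eq_of_mul_eq_mul_right (pow_pos hp.pos 2) (h1.symm.trans (by ring))
  have hZc : Z ≤ Subgroup.center (G ⧸ L) := by
    rintro _ ⟨w, hw, rfl⟩
    rw [Subgroup.mem_center_iff, hπs.forall]
    intro g
    have h1 := (hπ1 _).2 (hZL (h.Wcomm w hw g))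
    rw [map_mul, map_mul, map_mul, map_inv, map_inv, mul_inv_eq_one, mul_inv_eq_iff_eq_mul] at h1
    exact h1
  have hconj : ∀ g, g ∉ Z → ∃ z ∈ Z, z ≠ 1 ∧ IsConj g (g * z) := by
    rw [hπs.forall]
    intro g hg
    rw [hZmem] at hg
    have hg' : g⁻¹ ∉ W := fun hh => hg (by simpa using W.inv_mem hh)
    obtain ⟨a, ha⟩ := h.Wnot g⁻¹ hg'
    have hc : a * g⁻¹ * a⁻¹ * g⁻¹⁻¹ ∈ commutator G := by
      have := Subgroup.commutator_mem_commutator (Subgroup.mem_top a) (Subgroup.mem_top g⁻¹)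
      rwa [commutatorElement_def] at this
    have hcL : a * g⁻¹ * a⁻¹ * g⁻¹⁻¹ ∉ L := by
      intro hh
      apply ha
      rw [← h.inter hp hZL hL hne]
      exact ⟨hh, hc⟩
    refine ⟨(π (a * g⁻¹ * a⁻¹ * g⁻¹⁻¹))⁻¹, Z.inv_mem ((hZmem _).2 (h.CW hc)), ?_, ?_⟩
    · rw [ne_eq, inv_eq_one, hπ1]; exact hcL
    · rw [isConj_iff]
      refine ⟨π a, ?_⟩
      rw [← map_inv, ← map_inv, ← map_mul, ← map_mul, ← map_mul]
      congr 1; group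
  have hnc : ¬ IsCyclic (G ⧸ L) := by
    intro hc
    obtain ⟨g, hg⟩ : ∃ g, g ∉ Z := by
      by_contra! hh
      have : Z = ⊤ := (Subgroup.eq_top_iff' Z).2 hh
      rw [this, Subgroup.card_top, hQ] at hZ
      have := Nat.pow_right_injective hp.two_le (hZ.trans (pow_one p).symm)
      omega
    obtain ⟨z, hz, hz1, hcj⟩ := hconj g hg
    obtain ⟨c, hc'⟩ := isConj_iff.1 hcj
    have hcc : c * g = g * c := by
      let := IsCyclic.commGroup (α := G ⧸ L)
      exact mul_comm c g
    rw [hcc] at hc'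
    apply hz1
    simpa using hc'
  obtain ⟨y, hy, hyp⟩ := aux_p3 hp hodd hQ hnc Z hZ.le
  have hy1 : y ≠ 1 := fun hh => hy (hh ▸ Subgroup.one_mem _)
  have hyo : orderOf y = p := orderOf_eq_prime hyp hy1
  have hcd : Nat.card (Subgroup.zpowers y) = p := by rw [Nat.card_zpowers, hyo]
  have hdis : Disjoint (Subgroup.zpowers y) Z := by
    rw [Subgroup.disjoint_def]
    intro z hz hzS
    by_contra hz1
    apply hy
    have h1 := mem_zpowers_of_prime_card (g := (⟨z, hz⟩ : Subgroup.zpowers y))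
      (g' := ⟨y, Subgroup.mem_zpowers y⟩) hcd (fun hh => hz1 (congrArg Subtype.val hh))
    obtain ⟨k, hk⟩ := h1
    have h2 : y = z ^ k := by simpa using (congrArg Subtype.val hk).symm
    rw [h2]; exact Z.zpow_mem hzS k
  obtain ⟨ρ, hρ⟩ := aux_block' F Z (Subgroup.zpowers y) p hZc hZ hdis
    (by rw [hcd, hQ]; ring) hconj
  refine ⟨ρ.comp π, fun g => ?_⟩
  have := hρ (π g)
  simp only [hπ1, hZmem] at this
  exact this

open Classical in
lemma AuxFacts.block_Z {p : ℕ} (hp : p.Prime) (hodd : Odd p) (F : Type) [Field F] [Algebra ℚ F]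
    [IsCyclotomicExtension {p} ℚ F] {G : Type} [Group G] [Finite G]
    {W : Subgroup G} (h : AuxFacts p G W) :
    ∃ ρ : G →* Matrix (Fin (p ^ 2)) (Fin (p ^ 2)) F, ∀ g,
      Algebra.trace ℚ F (Matrix.trace (ρ g)) =
        p ^ 2 * (p * (if g = 1 then 1 else 0) - (if g ∈ Subgroup.center G then 1 else 0)) := by
  have : Fact p.Prime := ⟨hp⟩
  obtain ⟨K, hK, hKZ⟩ := h.exists_K hp hodd
  have : Nontrivial (Subgroup.center G) := by
    apply Finite.one_lt_card_iff_nontrivial.1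
    rw [h.cardZ]; exact hp.one_lt
  obtain ⟨z, hz⟩ := exists_ne (1 : Subgroup.center G)
  obtain ⟨ρ, hρ⟩ := aux_block' F (Subgroup.center G) K (p ^ 2) le_rfl h.cardZ hKZ
    (by rw [hK, h.cardG]; ring)
    (fun g hg => ⟨z, z.2, fun hh => hz (Subtype.ext hh), h.cam g hg z z.2⟩)
  refine ⟨ρ, fun g => ?_⟩
  rw [hρ g]; push_cast; congr!

/-- The index type of the middle blocks. -/
abbrev AuxIdx (p : ℕ) (G : Type) [Group G] (W : Subgroup G) : Type :=
  {L : Subgroup G // Subgroup.center G ≤ L ∧ L ≤ W ∧ Nat.card L = p ^ 2 ∧ L ≠ commutator G}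

lemma AuxFacts.existsUnique {p : ℕ} (hp : p.Prime) {G : Type} [Group G] [Finite G]
    {W : Subgroup G} (h : AuxFacts p G W) (g : G) (hgW : g ∈ W) (hg : g ∉ commutator G) :
    ∃ L : AuxIdx p G W, ∀ L' : AuxIdx p G W, g ∈ L'.1 ↔ L' = L := by
  let π := QuotientGroup.mk' (Subgroup.center G)
  have hπ1 : ∀ g, π g = 1 ↔ g ∈ Subgroup.center G := fun g => QuotientGroup.eq_one_iff g
  have hgo : orderOf (π g) = p := by
    have : Fact p.Prime := ⟨hp⟩
    apply orderOf_eq_prime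
    · rw [← map_pow, hπ1]; exact h.Wpow g hgW
    · rw [ne_eq, hπ1]; exact fun hh => hg (h.ZC hh)
  let L : Subgroup G := (Subgroup.zpowers (π g)).comap π
  have hLc : Nat.card L = p ^ 2 := by
    have := aux_card_comap (Subgroup.center G) (Subgroup.zpowers (π g))
    rw [Nat.card_zpowers, hgo, h.cardZ, ← pow_two] at this
    exact this
  have hgL : g ∈ L := Subgroup.mem_zpowers (π g)
  have hmin : ∀ S : Subgroup G, Subgroup.center G ≤ S → g ∈ S → L ≤ S := by
    intro S hS hgS x hx
    obtain ⟨k, hk⟩ := hx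
    have h1 : π ((g ^ k)⁻¹ * x) = 1 := by
      rw [map_mul, map_inv, map_zpow, inv_mul_eq_one]; exact hk
    have h2 := S.mul_mem (S.zpow_mem hgS k) (hS ((hπ1 _).1 h1))
    simpa using h2
  have hZL : Subgroup.center G ≤ L := fun z hz => by
    change π z ∈ Subgroup.zpowers (π g)
    rw [(hπ1 z).2 hz]; exact Subgroup.one_mem _
  refine ⟨⟨L, hZL, hmin W (h.ZC.trans h.CW) hgW, hLc, fun hh => hg (hh ▸ hgL)⟩, fun L' => ?_⟩
  constructor
  · intro hL'
    apply Subtype.ext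
    exact (Subgroup.eq_of_le_of_card_ge (hmin _ L'.2.1 hL') (by rw [hLc, L'.2.2.2.1])).symm
  · rintro rfl; exact hgL

open Classical in
lemma AuxFacts.indicator {p : ℕ} (hp : p.Prime) {G : Type} [Group G] [Finite G]
    {W : Subgroup G} (h : AuxFacts p G W) [Fintype (AuxIdx p G W)] (g : G) :
    (∑ L : AuxIdx p G W, (if g ∈ L.1 then (1 : ℚ) else 0)) + (if g ∈ commutator G then 1 else 0) =
      (Nat.card (AuxIdx p G W)) * (if g ∈ Subgroup.center G then 1 else 0) +
        (if g ∈ W then 1 else 0) := by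
  by_cases hgZ : g ∈ Subgroup.center G
  · have h1 : ∀ L : AuxIdx p G W, g ∈ L.1 := fun L => L.2.1 hgZ
    simp [hgZ, h1, h.ZC hgZ, h.CW (h.ZC hgZ)]
  by_cases hgC : g ∈ commutator G
  · have h1 : ∀ L : AuxIdx p G W, g ∉ L.1 := fun L hL => hgZ (by
      rw [← h.inter hp L.2.1 L.2.2.2.1 L.2.2.2.2]; exact ⟨hL, hgC⟩)
    simp [hgZ, h1, hgC, h.CW hgC]
  by_cases hgW : g ∈ W
  · obtain ⟨L, hL⟩ := h.existsUnique hp g hgW hgC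
    simp [hL, hgZ, hgC, hgW]
  · have h1 : ∀ L : AuxIdx p G W, g ∉ L.1 := fun L hL => hgW (L.2.2.1 hL)
    simp [hgZ, h1, hgC, hgW]

open Classical in
lemma AuxFacts.card_idx {p : ℕ} (hp : p.Prime) {G : Type} [Group G] [Finite G]
    {W : Subgroup G} (h : AuxFacts p G W) : Nat.card (AuxIdx p G W) = p := by
  have : Fintype G := Fintype.ofFinite G
  have : Fintype (AuxIdx p G W) := Fintype.ofFinite _
  have hS : ∀ S : Subgroup G, ∑ g : G, (if g ∈ S then (1 : ℚ) else 0) = Nat.card S := by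
    intro S
    rw [Finset.sum_boole, Nat.card_eq_fintype_card, Fintype.card_subtype]
  have hSZ : ∀ inst : DecidablePred (fun g : G => g ∈ Subgroup.center G),
      ∑ g : G, (@ite ℚ (g ∈ Subgroup.center G) (inst g) 1 0) =
      Nat.card (Subgroup.center G) := by
    intro inst
    rw [← hS]; congr!
  have h1 := Finset.sum_congr (rfl : (Finset.univ : Finset G) = Finset.univ)
    (fun g _ => h.indicator hp g)
  rw [Finset.sum_add_distrib, Finset.sum_comm, Finset.sum_add_distrib, ← Finset.mul_sum, hS, hS W,
    hSZ (fun i => @Subgroup.decidableMemCenter G _ i (Classical.propDecidable _))] at h1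
  have h2 : ∀ L : AuxIdx p G W, ∑ g : G, (if g ∈ L.1 then (1 : ℚ) else 0) = (p : ℚ) ^ 2 := by
    intro L; rw [hS, L.2.2.2.1]; push_cast; rfl
  simp only [h2] at h1
  rw [Finset.sum_const, Finset.card_univ, ← Nat.card_eq_fintype_card, h.cardC, h.cardZ, h.cardW,
    nsmul_eq_mul] at h1
  push_cast at h1
  have hp0 : (p : ℚ) ≠ 0 := by exact_mod_cast hp.ne_zero
  have hp1 : (p : ℚ) - 1 ≠ 0 := sub_ne_zero.2 (by exact_mod_cast hp.one_lt.ne')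
  have h3 : ((Nat.card (AuxIdx p G W) : ℚ) - p) * (p * (p - 1)) = 0 := by linear_combination h1
  have h4 := (mul_eq_zero.1 h3).resolve_right (mul_ne_zero hp0 hp1)
  exact_mod_cast sub_eq_zero.1 h4

/-- The target of the Wedderburn decomposition. -/
abbrev AuxTarget (p : ℕ) (F : Type) [Field F] (A : Type) [Group A] : Type :=
  MonoidAlgebra ℚ A × (Fin p → Matrix (Fin p) (Fin p) F) × Matrix (Fin (p ^ 2)) (Fin (p ^ 2)) F

lemma aux_finrank_monoidAlgebra (G : Type) [Group G] [Finite G] :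
    Module.finrank ℚ (MonoidAlgebra ℚ G) = Nat.card G := by
  have : Fintype G := Fintype.ofFinite G
  rw [(MonoidAlgebra.coeffLinearEquiv ℚ (S := ℚ) (M := G)).finrank_eq,
    Module.finrank_finsupp_self, Nat.card_eq_fintype_card]

lemma aux_finite_monoidAlgebra (G : Type) [Group G] [Finite G] :
    Module.Finite ℚ (MonoidAlgebra ℚ G) :=
  Module.Finite.equiv (MonoidAlgebra.coeffLinearEquiv ℚ (S := ℚ) (M := G)).symm

open Classical in
lemma AuxFacts.decomp {p : ℕ} (hp : p.Prime) (hodd : Odd p) (F : Type) [Field F] [Algebra ℚ F]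
    [IsCyclotomicExtension {p} ℚ F] {G : Type} [Group G] [Finite G]
    {W : Subgroup G} (h : AuxFacts p G W) :
    Nonempty (MonoidAlgebra ℚ G ≃ₐ[ℚ] AuxTarget p F (Abelianization G)) := by
  have : NeZero p := ⟨hp.ne_zero⟩
  have : Fintype (AuxIdx p G W) := Fintype.ofFinite _
  have hcardI := h.card_idx hp
  let e : Fin p ≃ AuxIdx p G W := (Finite.equivFinOfCardEq hcardI).symm
  have hFfin : Module.Finite ℚ F := IsCyclotomicExtension.finiteDimensional {p} ℚ F
  have hFr : Module.finrank ℚ F = p - 1 := by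
    rw [IsCyclotomicExtension.finrank F (Polynomial.cyclotomic.irreducible_rat hp.pos),
      Nat.totient_prime hp]
  choose ρ hρ using fun L : AuxIdx p G W => h.block_L hp hodd F L.2.1 L.2.2.1 L.2.2.2.1 L.2.2.2.2
  obtain ⟨σ, hσ⟩ := h.block_Z hp hodd F
  let θ : G →* AuxTarget p F (Abelianization G) :=
    MonoidHom.prod ((MonoidAlgebra.of ℚ (Abelianization G)).comp Abelianization.of)
      (MonoidHom.prod (MonoidHom.pi fun i => ρ (e i)) σ)
  let Φ : MonoidAlgebra ℚ G →ₐ[ℚ] AuxTarget p F (Abelianization G) := MonoidAlgebra.lift ℚ _ G θ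
  have hΦ : ∀ g r, Φ (MonoidAlgebra.single g r) = r • θ g := fun g r =>
    MonoidAlgebra.lift_single θ g r
  -- the regular trace, up to a scalar
  let ψ : AuxTarget p F (Abelianization G) → ℚ := fun b =>
    (p : ℚ) ^ 2 * b.1.coeff 1 + ∑ i, Algebra.trace ℚ F (Matrix.trace (b.2.1 i)) +
      p * Algebra.trace ℚ F (Matrix.trace b.2.2)
  have hψadd : ∀ a b, ψ (a + b) = ψ a + ψ b := by
    intro a b
    simp only [ψ, Prod.fst_add, Prod.snd_add, Pi.add_apply, Matrix.trace_add, map_add,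
      Finset.sum_add_distrib, MonoidAlgebra.coeff_add, Finsupp.add_apply]
    ring
  have hψsmul : ∀ (r : ℚ) b, ψ (r • b) = r * ψ b := by
    intro r b
    have ht : ∀ (n : ℕ) (M : Matrix (Fin n) (Fin n) F),
        Algebra.trace ℚ F (Matrix.trace (r • M)) = r * Algebra.trace ℚ F (Matrix.trace M) := by
      intro n M
      change Algebra.trace ℚ F (∑ i, r • M i i) = r * Algebra.trace ℚ F (∑ i, M i i)
      rw [map_sum, map_sum, Finset.mul_sum]
      exact Finset.sum_congr rfl fun i _ => by rw [map_smul, smul_eq_mul]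
    simp only [ψ, Prod.smul_fst, Prod.smul_snd, Pi.smul_apply, ht,
      MonoidAlgebra.coeff_smul, Finsupp.smul_apply, smul_eq_mul, ← Finset.mul_sum]
    ring
  have hψθ : ∀ g, ψ (θ g) = (p : ℚ) ^ 4 * (if g = 1 then 1 else 0) := by
    intro g
    have h1 : ψ (θ g) = (p : ℚ) ^ 2 * (MonoidAlgebra.of ℚ (Abelianization G) (Abelianization.of g)).coeff 1
      + ∑ i, Algebra.trace ℚ F (Matrix.trace (ρ (e i) g)) +
        p * Algebra.trace ℚ F (Matrix.trace (σ g)) := rfl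
    have h2 : (MonoidAlgebra.of ℚ (Abelianization G) (Abelianization.of g)).coeff 1 =
        if g ∈ commutator G then 1 else 0 := by
      rw [MonoidAlgebra.of_apply, MonoidAlgebra.coeff_single, Finsupp.single_apply]
      have h3 : Abelianization.of g = 1 ↔ g ∈ commutator G := by
        rw [← MonoidHom.mem_ker, Abelianization.ker_of]
      simp only [h3]
    have h4 : ∑ i, Algebra.trace ℚ F (Matrix.trace (ρ (e i) g)) =
        ∑ L, Algebra.trace ℚ F (Matrix.trace (ρ L g)) :=
      Equiv.sum_comp e (fun L => Algebra.trace ℚ F (Matrix.trace (ρ L g)))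
    have h5 := h.indicator hp g
    rw [h1, h2, h4, hσ]
    simp only [hρ]
    rw [← Finset.mul_sum, Finset.sum_sub_distrib, ← Finset.mul_sum, Finset.sum_const,
      Finset.card_univ, ← Nat.card_eq_fintype_card, hcardI, nsmul_eq_mul]
    rw [hcardI] at h5
    linear_combination (p : ℚ) ^ 2 * h5
  have hψΦ : ∀ x, ψ (Φ x) = (p : ℚ) ^ 4 * x.coeff 1 := by
    intro x
    induction x using MonoidAlgebra.induction_linear with
    | zero => 
      rw [map_zero]
      have := hψsmul 0 0
      simpa using this
    | add a b ha hb => rw [map_add, hψadd, ha, hb, MonoidAlgebra.coeff_add, Finsupp.add_apply]; ring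
    | single g r =>
      rw [hΦ, hψsmul, hψθ, MonoidAlgebra.coeff_single, Finsupp.single_apply]
      by_cases hg : g = 1 <;> simp [hg]; ring
  have hp4 : (p : ℚ) ^ 4 ≠ 0 := pow_ne_zero _ (by exact_mod_cast hp.ne_zero)
  have hinj : Function.Injective Φ := by
    rw [injective_iff_map_eq_zero]
    intro x hx
    apply MonoidAlgebra.ext
    ext g
    have h1 := hψΦ (x * MonoidAlgebra.single g⁻¹ 1)
    rw [map_mul, hx, zero_mul] at h1
    have h2 : ψ 0 = 0 := by simpa using hψsmul 0 0
    rw [h2] at h1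
    have h3 := (mul_eq_zero.1 h1.symm).resolve_left hp4
    rw [MonoidAlgebra.coeff_mul_single_eq_coeff_mul (m₂ := g)
      (fun m' _ => by rw [mul_inv_eq_one]), mul_one] at h3
    simpa using h3
  have hAbc : Nat.card (Abelianization G) = p ^ 3 := by
    have h1 := Subgroup.card_eq_card_quotient_mul_card_subgroup (commutator G)
    rw [h.cardG, h.cardC] at h1
    exact Nat.eq_of_mul_eq_mul_right (pow_pos hp.pos 2) (h1.symm.trans (by ring))
  have : Finite (Abelianization G) := Quotient.finite _
  have hf1 := aux_finite_monoidAlgebra G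
  have hf2 := aux_finite_monoidAlgebra (Abelianization G)
  have hMf : ∀ n, Module.Finite ℚ (Matrix (Fin n) (Fin n) F) := fun n => Module.Finite.matrix
  have hrank : Module.finrank ℚ (MonoidAlgebra ℚ G) =
      Module.finrank ℚ (AuxTarget p F (Abelianization G)) := by
    rw [Module.finrank_prod, Module.finrank_prod, Module.finrank_pi_fintype,
      Module.finrank_matrix, Module.finrank_matrix, aux_finrank_monoidAlgebra,
      aux_finrank_monoidAlgebra, hAbc, h.cardG, hFr]
    simp only [Fintype.card_fin, Finset.sum_const, Finset.card_univ, smul_eq_mul]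
    obtain ⟨q, hq⟩ : ∃ q, p = q + 1 := ⟨p - 1, (Nat.succ_pred_prime hp).symm⟩
    rw [hq, Nat.add_sub_cancel]; ring
  have hbij : Function.Bijective Φ :=
    ⟨hinj, (LinearMap.injective_iff_surjective_of_finrank_eq_finrank (f := Φ.toLinearMap) hrank).1 hinj⟩
  exact ⟨AlgEquiv.ofBijective Φ hbij⟩

lemma aux_pi_zmod_congr {k : ℕ} (a b : Fin k → ℕ) (σ : Fin k ≃ Fin k) (hσ : ∀ i, a i = b (σ i)) :
    Nonempty (((i : Fin k) → Multiplicative (ZMod (a i))) ≃*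
      ((i : Fin k) → Multiplicative (ZMod (b i)))) := by
  obtain rfl : a = fun i => b (σ i) := funext hσ
  exact ⟨{ Equiv.piCongrLeft (fun i => Multiplicative (ZMod (b i))) σ with
    map_mul' := fun x y => by
      funext j
      obtain ⟨i, rfl⟩ := σ.surjective j
      simp }⟩

lemma aux_struct {p : ℕ} (hp : p.Prime) (A : Type) [CommGroup A] (hA : Nat.card A = p ^ 3) :
    ∃ (k : ℕ) (e : Fin k → ℕ), (∀ i, 1 ≤ e i) ∧ ∑ i, e i = 3 ∧
      Nat.card (powMonoidHom p : A →* A).ker = p ^ k ∧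
      Nonempty (A ≃* ((i : Fin k) → Multiplicative (ZMod (p ^ e i)))) := by
  have : Finite A := Nat.finite_of_card_ne_zero (by rw [hA]; exact pow_ne_zero _ hp.ne_zero)
  obtain ⟨ι, _, n, hn, ⟨f⟩⟩ := CommGroup.equiv_prod_multiplicative_zmod_of_finite A
  have hcard : ∏ i, n i = p ^ 3 := by
    rw [← hA, Nat.card_congr f.toEquiv, Nat.card_pi]
    exact Finset.prod_congr rfl fun i _ => (Nat.card_zmod (n i)).symm
  have hdvd : ∀ i, ∃ e, n i = p ^ e := by
    intro i
    have : n i ∣ p ^ 3 := hcard ▸ Finset.dvd_prod_of_mem n (Finset.mem_univ i)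
    obtain ⟨e, -, he⟩ := (Nat.dvd_prime_pow hp).1 this
    exact ⟨e, he⟩
  choose e he using hdvd
  obtain rfl : n = fun i => p ^ e i := funext he
  have he1 : ∀ i, 1 ≤ e i := by
    intro i
    by_contra h
    have : e i = 0 := by omega
    have := hn i
    simp_all
  let s := Fintype.equivFin ι
  refine ⟨Fintype.card ι, fun i => e (s.symm i), fun i => he1 _, ?_, ?_, ?_⟩
  · rw [Equiv.sum_comp s.symm e]
    rw [Finset.prod_pow_eq_pow_sum] at hcard
    exact Nat.pow_right_injective hp.two_le hcard
  · have h1 : ∀ i : ι, Nat.card {x : Multiplicative (ZMod (p ^ e i)) // x ^ p = 1} = p := by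
      intro i
      have : NeZero (p ^ e i) := ⟨pow_ne_zero _ hp.ne_zero⟩
      have hc : IsCyclic (Multiplicative (ZMod (p ^ e i))) := inferInstance
      have h2 := IsCyclic.card_powMonoidHom_ker (Multiplicative (ZMod (p ^ e i))) p
      have h3 : Nat.card (Multiplicative (ZMod (p ^ e i))) = p ^ e i := Nat.card_zmod _
      rw [h3, Nat.gcd_eq_right (dvd_pow_self p (by have := he1 i; omega))] at h2
      exact h2
    have h2 : (powMonoidHom p : A →* A).ker ≃
        ((i : ι) → {x : Multiplicative (ZMod (p ^ e i)) // x ^ p = 1}) :=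
      { toFun := fun x i => ⟨f x.1 i, by
          have h3 : x.1 ^ p = 1 := x.2
          have h4 := congrFun (congrArg f h3) i
          simpa using h4⟩
        invFun := fun y => ⟨f.symm fun i => (y i).1, by
          change (f.symm fun i => (y i).1) ^ p = 1
          rw [← map_pow, ← map_one f.symm]
          congr 1
          funext i
          exact (y i).2⟩
        left_inv := fun x => by simp
        right_inv := fun y => by simp }
    rw [Nat.card_congr h2, Nat.card_pi, Finset.prod_congr rfl (fun i _ => h1 i)]
    simp
  · refine ⟨f.trans
      { Equiv.piCongrLeft' (fun i => Multiplicative (ZMod (p ^ e i))) s with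
        map_mul' := fun x y => by funext j; simp }⟩

lemma aux_iso {p : ℕ} (hp : p.Prime) (A B : Type) [CommGroup A] [CommGroup B]
    (hA : Nat.card A = p ^ 3) (hB : Nat.card B = p ^ 3)
    (hAB : Nat.card (powMonoidHom p : A →* A).ker = Nat.card (powMonoidHom p : B →* B).ker) :
    Nonempty (A ≃* B) := by
  obtain ⟨k, a, ha, hsa, hka, ⟨f⟩⟩ := aux_struct hp A hA
  obtain ⟨l, b, hb, hsb, hkb, ⟨g⟩⟩ := aux_struct hp B hB
  rw [hka, hkb] at hAB
  obtain rfl : k = l := Nat.pow_right_injective hp.two_le hAB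
  suffices h : ∃ σ : Fin k ≃ Fin k, ∀ i, a i = b (σ i) by
    obtain ⟨σ, hσ⟩ := h
    obtain ⟨t⟩ := aux_pi_zmod_congr (fun i => p ^ a i) (fun i => p ^ b i) σ
      (fun i => by simp only [hσ i])
    exact ⟨f.trans (t.trans g.symm)⟩
  have hk : k ≤ 3 := by
    have : ∑ i : Fin k, 1 ≤ ∑ i, a i := Finset.sum_le_sum fun i _ => ha i
    simpa [hsa] using this
  interval_cases k
  · simp at hsa
  · refine ⟨Equiv.refl _, fun i => ?_⟩
    fin_cases i
    simp at hsa hsb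
    simp [hsa, hsb]
  · rw [Fin.sum_univ_two] at hsa hsb
    have := ha 0; have := ha 1; have := hb 0; have := hb 1
    by_cases h : a 0 = b 0
    · refine ⟨Equiv.refl _, fun i => ?_⟩
      fin_cases i <;> simp <;> omega
    · refine ⟨Equiv.swap 0 1, fun i => ?_⟩
      fin_cases i <;> simp <;> omega
  · rw [Fin.sum_univ_three] at hsa hsb
    have := ha 0; have := ha 1; have := hb 0; have := hb 1; have := ha 2; have := hb 2
    refine ⟨Equiv.refl _, fun i => ?_⟩
    fin_cases i <;> simp <;> omega

lemma aux_card_hom {p : ℕ} (hp : p.Prime) (hodd : Odd p) (F : Type) [Field F] [Algebra ℚ F]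
    [IsCyclotomicExtension {p} ℚ F] (A : Type) [CommGroup A] (hA : Nat.card A = p ^ 3) :
    Nat.card (A →* F) = Nat.card (powMonoidHom p : A →* A).ker := by
  have : Finite A := Nat.finite_of_card_ne_zero (by rw [hA]; exact pow_ne_zero _ hp.ne_zero)
  have : NeZero p := ⟨hp.ne_zero⟩
  have : Module.Finite ℚ F := IsCyclotomicExtension.finiteDimensional {p} ℚ F
  have hζ := IsCyclotomicExtension.zeta_spec p ℚ F
  -- roots of unity of `p`-power order in `F` have order dividing `p`
  have hroot : ∀ k (u : F), u ^ p ^ k = 1 → u ^ p = 1 := by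
    intro k u hu
    have h1 : orderOf u ∣ p ^ k := orderOf_dvd_of_pow_eq_one hu
    obtain ⟨j, -, hj⟩ := (Nat.dvd_prime_pow hp).1 h1
    have h2 : IsPrimitiveRoot u (p ^ j) := hj ▸ IsPrimitiveRoot.orderOf u
    have hj1 : j ≤ 1 := by
      by_contra hlt
      have hlt : 1 < j := by omega
      have h3 := IsPrimitiveRoot.lcm_totient_le_finrank (K := ℚ) h2 h2
        (Polynomial.cyclotomic.irreducible_rat (by rw [Nat.lcm_self]; exact pow_pos hp.pos _))
      rw [Nat.lcm_self, IsCyclotomicExtension.finrank F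
        (Polynomial.cyclotomic.irreducible_rat hp.pos), Nat.totient_prime hp,
        Nat.totient_prime_pow hp (by omega)] at h3
      have h4 : 0 < p - 1 := by have := hp.two_le; omega
      have h5 : p ^ (j - 1) ≤ 1 := by
        by_contra h6
        have : 1 < p ^ (j - 1) := by omega
        nlinarith
      have h6 : 1 < p ^ (j - 1) := Nat.one_lt_pow (by omega) hp.one_lt
      omega
    rw [← orderOf_dvd_iff_pow_eq_one, hj]
    calc p ^ j ∣ p ^ 1 := pow_dvd_pow p hj1
      _ = p := pow_one p
  let P : A →* A := powMonoidHom p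
  let B := A ⧸ P.range
  have hBexp : Monoid.exponent B ∣ p := by
    apply Monoid.exponent_dvd_of_forall_pow_eq_one
    intro b
    obtain ⟨a, rfl⟩ := QuotientGroup.mk_surjective b
    rw [← QuotientGroup.mk_pow, QuotientGroup.eq_one_iff]
    exact ⟨a, rfl⟩
  have hEp : HasEnoughRootsOfUnity F p := 
    { prim := ⟨_, hζ⟩
      cyc := inferInstance }
  have hE : HasEnoughRootsOfUnity F (Monoid.exponent B) := HasEnoughRootsOfUnity.of_dvd F hBexp
  have h1 := CommGroup.card_monoidHom_of_hasEnoughRootsOfUnity B F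
  have h2 : Nat.card B = Nat.card P.ker := by
    have h3 := Subgroup.card_eq_card_quotient_mul_card_subgroup P.range
    have h4 := Subgroup.card_mul_index P.ker
    rw [Subgroup.index_ker, h3] at h4
    exact (Nat.eq_of_mul_eq_mul_right Nat.card_pos h4).symm
  rw [← h2, ← h1]
  refine (Nat.card_congr (Equiv.ofBijective
    (fun χ : B →* Fˣ => (Units.coeHom F).comp (χ.comp (QuotientGroup.mk' P.range))) ⟨?_, ?_⟩)).symm
  · intro χ χ' h
    ext a
    exact DFunLike.congr_fun h a
  · intro χ
    refine ⟨QuotientGroup.lift P.range χ.toHomUnits ?_, ?_⟩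
    · rintro _ ⟨a, rfl⟩
      apply Units.ext
      change χ (a ^ p) = 1
      rw [map_pow]
      apply hroot 3
      rw [← map_pow, ← hA, pow_card_eq_one', map_one]
    · ext a
      rfl

lemma aux_forward {p : ℕ} (hp : p.Prime) (hodd : Odd p) (F : Type) [Field F] [Algebra ℚ F]
    [IsCyclotomicExtension {p} ℚ F] {G H : Type} [Group G] [Group H]
    (hG : Nat.card (Abelianization G) = p ^ 3) (hH : Nat.card (Abelianization H) = p ^ 3)
    (f : MonoidAlgebra ℚ G ≃ₐ[ℚ] MonoidAlgebra ℚ H) :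
    Nonempty (Abelianization G ≃* Abelianization H) := by
  apply aux_iso hp _ _ hG hH
  rw [← aux_card_hom hp hodd F _ hG, ← aux_card_hom hp hodd F _ hH]
  have key : ∀ (K : Type) [Group K], Nat.card (Abelianization K →* F) =
      Nat.card (MonoidAlgebra ℚ K →ₐ[ℚ] F) := by
    intro K _
    rw [← Nat.card_congr (MonoidAlgebra.lift ℚ F K)]
    refine Nat.card_congr (Equiv.ofBijective (fun χ => χ.comp Abelianization.of) ⟨?_, ?_⟩)
    · intro χ χ' h
      ext a
      exact DFunLike.congr_fun h a
    · intro χ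
      refine ⟨(Units.coeHom F).comp (Abelianization.lift χ.toHomUnits), ?_⟩
      ext a
      rfl
  rw [key, key]
  exact Nat.card_congr (f.arrowCongr AlgEquiv.refl)

theorem stmt_15 {p : ℕ} (hp : p.Prime) (hodd : Odd p)
    {G H : Type} [Group G] [Fintype G] [Group H] [Fintype H]
    (hcardG : Nat.card G = p ^ 5) (hcardH : Nat.card H = p ^ 5)
    (hZG : Nat.card (Subgroup.center G) = p) (hZH : Nat.card (Subgroup.center H) = p)
    (hcpG : IsCaminaPairCenter G) (hcpH : IsCaminaPairCenter H)
    (hVZG : IsVZGroup (G ⧸ Subgroup.center G)) (hVZH : IsVZGroup (H ⧸ Subgroup.center H))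
    (hZbarG : Nat.card (Subgroup.center (G ⧸ Subgroup.center G)) = p ^ 2)
    (hZbarH : Nat.card (Subgroup.center (H ⧸ Subgroup.center H)) = p ^ 2)
    (hZbarexpG : ∀ z ∈ Subgroup.center (G ⧸ Subgroup.center G), z ^ p = 1)
    (hZbarexpH : ∀ z ∈ Subgroup.center (H ⧸ Subgroup.center H), z ^ p = 1)
    (hG'barG : Nat.card (commutator (G ⧸ Subgroup.center G)) = p)
    (hG'barH : Nat.card (commutator (H ⧸ Subgroup.center H)) = p) :
    Nonempty (MonoidAlgebra ℚ G ≃ₐ[ℚ] MonoidAlgebra ℚ H) ↔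
      Nonempty (Abelianization G ≃* Abelianization H) := by
  have hFp : Fact p.Prime := ⟨hp⟩
  have hNp : NeZero p := ⟨hp.ne_zero⟩
  have hNq : NeZero ((p : ℕ) : ℚ) := ⟨by exact_mod_cast hp.ne_zero⟩
  have hfG := aux_facts hp hcardG hZG hcpG.2.1 hcpG.2.2 hZbarG hZbarexpG hG'barG
  have hfH := aux_facts hp hcardH hZH hcpH.2.1 hcpH.2.2 hZbarH hZbarexpH hG'barH
  have hcyc : IsCyclotomicExtension {p} ℚ (CyclotomicField p ℚ) :=
    CyclotomicField.isCyclotomicExtension p ℚ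
  have hcard : ∀ (K : Type) [Group K] [Finite K], Nat.card K = p ^ 5 →
      Nat.card (commutator K) = p ^ 2 → Nat.card (Abelianization K) = p ^ 3 := by
    intro K _ _ h5 h2
    have h1 := Subgroup.card_eq_card_quotient_mul_card_subgroup (commutator K)
    rw [h5, h2] at h1
    exact Nat.eq_of_mul_eq_mul_right (pow_pos hp.pos 2) (h1.symm.trans (by ring))
  constructor
  · rintro ⟨f⟩
    exact aux_forward hp hodd (CyclotomicField p ℚ) (hcard G hcardG hfG.cardC)
      (hcard H hcardH hfH.cardC) f
  · rintro ⟨e⟩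
    obtain ⟨a⟩ := hfG.decomp hp hodd (CyclotomicField p ℚ)
    obtain ⟨b⟩ := hfH.decomp hp hodd (CyclotomicField p ℚ)
    exact ⟨(a.trans (AlgEquiv.prodCongr (MonoidAlgebra.domCongr ℚ ℚ e) AlgEquiv.refl)).trans b.symm⟩
end

section
/- Let p be an odd prime and G a group of order p^5 such that Z(G) is elementary abelian of order p², G' is elementary abelian of order p³, and Z(G) is a proper subgroup of G'. Then G/Z(G) has exactly p − 1 nonlinear irreducible complex characters. Moreover, for every nonlinear irreducible complex character χ of G whose kernel does not contain Z(G), the subgroup K_χ = ker χ ∩ Z(G) has order p and χ is the lift (inflation) of a nonlinear irreducible character χ̄ of G/K_χ whose kernel does not contain Z(G)/K_χ; inflation gives a bijection between the set of pairs (K, χ̄), where K is a subgroup of Z(G) of order p and χ̄ is a nonlinear irreducible complex character of G/K whose kernel does not contain Z(G)/K, and the set of nonlinear irreducible complex characters of G whose kernel does not contain Z(G). -/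
section

open Representation Module
open scoped commutatorElement
open scoped IsMulCommutative

/-- Unbundled data: a finite-dimensional representation with norm-one character. -/
theorem isIrred_iff {G : Type} [Group G] [Fintype G] (χ : G → ℂ) :
    IsIrredCharacter χ ↔ ∃ (V : Type) (_ : AddCommGroup V) (_ : Module ℂ V)
      (_ : FiniteDimensional ℂ V) (ρ : Representation ℂ G V),
      finrank ℂ (IntertwiningMap ρ ρ) = 1 ∧ ρ.character = χ := by
  have hc : (Nat.card G : ℂ) ≠ 0 := by exact_mod_cast Nat.card_pos.ne'
  let _ := invertibleOfNonzero hc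
  constructor
  · rintro ⟨V, hV, rfl⟩
    refine ⟨V, inferInstance, inferInstance, inferInstance, V.ρ, ?_, rfl⟩
    rw [FDRep.simple_iff_char_is_norm_one] at hV
    have := card_inv_mul_sum_char_mul_char_eq_finrank V.ρ V.ρ
    have h2 : ∑ g : G, Representation.character V.ρ g * Representation.character V.ρ g⁻¹ = Nat.card G := hV
    rw [h2, inv_mul_cancel₀ hc] at this
    exact_mod_cast this.symm
  · rintro ⟨V, _, _, _, ρ, h, rfl⟩
    refine ⟨FDRep.of ρ, ?_, rfl⟩
    rw [FDRep.simple_iff_char_is_norm_one]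
    have := card_inv_mul_sum_char_mul_char_eq_finrank ρ ρ
    rw [h, inv_mul_eq_iff_eq_mul₀ hc, Nat.cast_one, mul_one] at this
    exact this

theorem norm_one {G : Type} [Group G] [Fintype G] {V : Type} [AddCommGroup V] [Module ℂ V]
    [FiniteDimensional ℂ V] {ρ : Representation ℂ G V} (h : finrank ℂ (IntertwiningMap ρ ρ) = 1) :
    ∑ g : G, ρ.character g * ρ.character g⁻¹ = Nat.card G := by
  have hc : (Nat.card G : ℂ) ≠ 0 := by exact_mod_cast Nat.card_pos.ne'
  let _ := invertibleOfNonzero hc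
  have := card_inv_mul_sum_char_mul_char_eq_finrank ρ ρ
  rw [h, inv_mul_eq_iff_eq_mul₀ hc] at this
  simpa using this

theorem dim_ne {G : Type} [Group G] [Fintype G] {V : Type} [AddCommGroup V] [Module ℂ V]
    [FiniteDimensional ℂ V] {ρ : Representation ℂ G V} (h : finrank ℂ (IntertwiningMap ρ ρ) = 1) :
    finrank ℂ V ≠ 0 := by
  intro h0
  have := finrank_zero_iff.1 h0
  have h1 := norm_one h
  have h2 : ∀ g, ρ.character g = 0 := fun g => by
    have : ρ g = 0 := Subsingleton.elim _ _
    simp [Representation.character, this]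
  simp [h2] at h1
  exact (Nat.card_pos (α := G)).ne' (by rw [Nat.card_eq_fintype_card]; exact_mod_cast h1.symm)

theorem schur {G : Type} [Group G] [Fintype G] {V : Type} [AddCommGroup V] [Module ℂ V]
    [FiniteDimensional ℂ V] {ρ : Representation ℂ G V} (h : finrank ℂ (IntertwiningMap ρ ρ) = 1)
    (g : G) (hg : ∀ x, ρ (g * x) = ρ (x * g)) : ∃ a : ℂ, ρ g = a • 1 := by
  have hne : (1 : IntertwiningMap ρ ρ) ≠ 0 := by
    intro h1
    have : ∀ v : V, v = 0 := fun v => by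
      have := congrArg (fun f : IntertwiningMap ρ ρ => f v) h1
      simpa using this
    apply dim_ne h
    rw [finrank_zero_iff]
    exact ⟨fun a b => by rw [this a, this b]⟩
  obtain ⟨a, ha⟩ := (finrank_eq_one_iff_of_nonzero' _ hne).1 h
    ⟨ρ g, fun x => by
      have := hg x
      rw [map_mul, map_mul] at this
      exact this⟩
  refine ⟨a, ?_⟩
  have := congrArg IntertwiningMap.toLinearMap ha
  exact this.symm

/-- irreducible characters of quotient. -/
theorem irred_quot {G : Type} [Group G] [Fintype G] {V : Type} [AddCommGroup V] [Module ℂ V]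
    [FiniteDimensional ℂ V] {ρ : Representation ℂ G V} (h : finrank ℂ (IntertwiningMap ρ ρ) = 1)
    (K : Subgroup G) [K.Normal] (hK : K ≤ MonoidHom.ker ρ) :
    ∃ χ : G ⧸ K → ℂ, IsIrredCharacter χ ∧ ρ.character = χ ∘ (QuotientGroup.mk : G → G ⧸ K) := by
  classical
  let σ : Representation ℂ (G ⧸ K) V := QuotientGroup.lift K ρ hK
  have hσ : ∀ g : G, σ (g : G ⧸ K) = ρ g := fun g => rfl
  refine ⟨σ.character, ?_, rfl⟩
  rw [isIrred_iff]
  refine ⟨V, _, _, inferInstance, σ, ?_, rfl⟩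
  rw [← h]
  refine LinearEquiv.finrank_eq
    { toFun := fun f => ⟨f.toLinearMap, fun g => f.2 (g : G ⧸ K)⟩
      invFun := fun f => ⟨f.toLinearMap, fun g => by
        induction g using QuotientGroup.induction_on with
        | H z => exact f.2 z⟩
      map_add' := fun _ _ => rfl
      map_smul' := fun _ _ => rfl
      left_inv := fun _ => rfl
      right_inv := fun _ => rfl }

theorem exists_irred {G : Type} [Group G] (C : Subgroup G) (lam : C → ℂ) (n : ℕ) :
    ∀ (V : Type) [AddCommGroup V] [Module ℂ V]
    [FiniteDimensional ℂ V] (ρ : Representation ℂ G V), finrank ℂ V = n → n ≠ 0 →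
      (∀ c : C, ρ c = lam c • 1) → 
    ∃ (V : Type) (_ : AddCommGroup V) (_ : Module ℂ V)
      (_ : FiniteDimensional ℂ V) (ρ : Representation ℂ G V),
      finrank ℂ (IntertwiningMap ρ ρ) = 1 ∧ (∀ c : C, ρ c = lam c • 1) := by
  induction n using Nat.strong_induction_on with
  | _ n ih =>
  intro V _ _ _ ρ hn h0 hc
  by_cases hS : ∀ S : Subrepresentation ρ, S.toSubmodule = ⊥ ∨ S.toSubmodule = ⊤
  · refine ⟨V, _, _, inferInstance, ρ, ?_, hc⟩
    have : IsIrreducible ρ :=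
      { exists_pair_ne := ⟨⊥, ⊤, fun h => by
          have h1 : (⊥ : Submodule ℂ V) = ⊤ := congrArg Subrepresentation.toSubmodule h
          have : finrank ℂ (⊤ : Submodule ℂ V) = 0 := by rw [← h1]; simp
          simp at this
          omega⟩
        eq_bot_or_eq_top := fun S => (hS S).imp
          (fun h => Subrepresentation.toSubmodule_injective h)
          (fun h => Subrepresentation.toSubmodule_injective h) }
    exact IsIrreducible.finrank_intertwiningMap_self ρ
  · push Not at hS
    obtain ⟨S, h1, h2⟩ := hS
    refine ih (finrank ℂ S.toSubmodule) ?_ S.toSubmodule S.toRepresentation rfl ?_ ?_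
    · rw [← hn]; exact Submodule.finrank_lt h2
    · rwa [Ne, Submodule.finrank_eq_zero]
    · intro c
      apply LinearMap.ext
      intro v
      apply Subtype.ext
      exact congrArg (fun f : V →ₗ[ℂ] V => f v) (hc c)

/-- right translation on functions. -/
def rightReg (G : Type) [Group G] : Representation ℂ G (G → ℂ) where
  toFun g := { toFun := fun f x => f (x * g), map_add' := fun _ _ => rfl, map_smul' := fun _ _ => rfl }
  map_one' := by ext f x; simp
  map_mul' a b := by
    apply LinearMap.ext; intro f; funext x
    simp [mul_assoc]

theorem exists_irred' {G : Type} [Group G] [Fintype G] (lam : Subgroup.center G →* ℂ) :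
    ∃ (V : Type) (_ : AddCommGroup V) (_ : Module ℂ V)
      (_ : FiniteDimensional ℂ V) (ρ : Representation ℂ G V),
      finrank ℂ (IntertwiningMap ρ ρ) = 1 ∧ (∀ c : Subgroup.center G, ρ c = lam c • 1) := by
  classical
  let S : Subrepresentation (rightReg G) :=
    { toSubmodule :=
      { carrier := {f | ∀ (c : Subgroup.center G) (x : G), f (x * c) = lam c * f x}
        add_mem' := fun {a b} ha hb c x => by
          simp only [Pi.add_apply]; rw [ha c x, hb c x]; ring
        zero_mem' := fun c x => by simp
        smul_mem' := fun r f hf c x => by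
          simp only [Pi.smul_apply, smul_eq_mul]; rw [hf c x]; ring }
      apply_mem_toSubmodule := fun g f hf c x => by
        change f (x * c * g) = lam c * f (x * g)
        rw [← hf c (x * g), mul_assoc, mul_assoc, (Subgroup.mem_center_iff.1 c.2 g)] }
  have hmem : ∀ f : G → ℂ, f ∈ S.toSubmodule ↔
    ∀ (c : Subgroup.center G) (x : G), f (x * c) = lam c * f x := fun f => Iff.rfl
  refine exists_irred (Subgroup.center G) lam _ S.toSubmodule S.toRepresentation rfl ?_ ?_
  · rw [Ne, Submodule.finrank_eq_zero]
    intro hb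
    have : (fun g => if h : g ∈ Subgroup.center G then lam ⟨g, h⟩ else 0 : G → ℂ) ∈ S.toSubmodule := by
      rw [hmem]
      intro c x
      by_cases hx : x ∈ Subgroup.center G
      · have := mul_mem hx c.2
        rw [dif_pos hx, dif_pos this, ← map_mul]
        congr 1
        exact Subtype.ext (Subgroup.mem_center_iff.1 hx c).symm
      · have : x * c ∉ Subgroup.center G := fun h => hx ((Subgroup.mul_mem_cancel_right _ c.2).1 h)
        rw [dif_neg hx, dif_neg this, mul_zero]
    rw [hb, Submodule.mem_bot] at this
    have := congrFun this 1
    simp only [one_mem, dite_true] at this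
    have h1 : lam 1 = 0 := this
    simp at h1
  · intro c
    apply LinearMap.ext
    intro f
    apply Subtype.ext
    funext x
    exact (hmem f).1 f.2 c x

theorem central_char {G : Type} [Group G] [Fintype G] {V : Type} [AddCommGroup V] [Module ℂ V]
    [FiniteDimensional ℂ V] {ρ : Representation ℂ G V} (h : finrank ℂ (IntertwiningMap ρ ρ) = 1) :
    ∃ lam : Subgroup.center G →* ℂˣ, ∀ c : Subgroup.center G, ρ c = (lam c : ℂ) • 1 := by
  have hs : ∀ c : Subgroup.center G, ∃ a : ℂ, ρ c = a • 1 := fun c =>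
    schur h c (fun x => by rw [Subgroup.mem_center_iff.1 c.2 x])
  choose a ha using hs
  have hV : Nontrivial V := by
    rw [← not_subsingleton_iff_nontrivial]
    intro hs
    exact dim_ne h (finrank_zero_iff.2 hs)
  have hinj : ∀ x y : ℂ, x • (1 : V →ₗ[ℂ] V) = y • 1 → x = y := by
    intro x y hxy
    obtain ⟨v, hv⟩ := exists_ne (0 : V)
    have := congrArg (fun f : V →ₗ[ℂ] V => f v) hxy
    exact smul_left_injective ℂ hv this
  let l : Subgroup.center G →* ℂ :=
    { toFun := a
      map_one' := hinj _ _ (by rw [← ha]; simp)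
      map_mul' := fun x y => hinj _ _ (by
        rw [← ha, Subgroup.coe_mul, map_mul, ha, ha]; rw [smul_mul_smul_comm, one_mul]) }
  exact ⟨l.toHomUnits, fun c => ha c⟩

theorem char_smul {G : Type} [Group G] {V : Type} [AddCommGroup V] [Module ℂ V]
    [FiniteDimensional ℂ V] {ρ : Representation ℂ G V} {g : G} {a : ℂ} (h : ρ g = a • 1) (x : G) :
    ρ.character (g * x) = a * ρ.character x := by
  simp [Representation.character, h]

theorem char_smul_one {G : Type} [Group G] {V : Type} [AddCommGroup V] [Module ℂ V]
    [FiniteDimensional ℂ V] {ρ : Representation ℂ G V} {g : G} {a : ℂ} (h : ρ g = a • 1) :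
    ρ.character g = a * finrank ℂ V := by
  have := char_smul h 1
  simpa using this

/-- If commutators act trivially then an irreducible representation is linear. -/
theorem linear_of_comm {G : Type} [Group G] [Fintype G] {V : Type} [AddCommGroup V] [Module ℂ V]
    [FiniteDimensional ℂ V] {ρ : Representation ℂ G V} (h : finrank ℂ (IntertwiningMap ρ ρ) = 1)
    (hc : ∀ x y, ρ (x * y) = ρ (y * x)) : finrank ℂ V = 1 := by
  have hs : ∀ g : G, ∃ a : ℂ, ρ g = a • 1 := fun g => schur h g (hc g)
  have hd := dim_ne h
  have hn := norm_one h
  have : ∀ g : G, ρ.character g * ρ.character g⁻¹ = (finrank ℂ V : ℂ) ^ 2 := by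
    intro g
    obtain ⟨a, ha⟩ := hs g
    have h1 := char_smul ha g⁻¹
    rw [mul_inv_cancel, Representation.char_one] at h1
    rw [char_smul_one ha, mul_right_comm, ← h1, sq]
  simp only [this, Finset.sum_const, Finset.card_univ, nsmul_eq_mul, Nat.card_eq_fintype_card] at hn
  have h3 : Fintype.card G * finrank ℂ V ^ 2 = Fintype.card G * 1 := by
    rw [mul_one]; exact_mod_cast hn
  have h4 := Nat.eq_of_mul_eq_mul_left Fintype.card_pos h3
  simpa using h4

/-- The faithful-type character attached to a central character. -/
noncomputable def chiOf {G : Type} [Group G] (p : ℕ) (lam : Subgroup.center G →* ℂˣ) (g : G) : ℂ :=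
  open Classical in if h : g ∈ Subgroup.center G then (lam ⟨g, h⟩ : ℂ) * p else 0

theorem char_eq_chiOf {p : ℕ} (hp : p.Prime) {G : Type} [Group G] [Fintype G]
    (hcard : Nat.card G = p ^ 3) (hZ : Nat.card (Subgroup.center G) = p)
    (hcomm : commutator G ≤ Subgroup.center G)
    {V : Type} [AddCommGroup V] [Module ℂ V]
    [FiniteDimensional ℂ V] {ρ : Representation ℂ G V} (h : finrank ℂ (IntertwiningMap ρ ρ) = 1)
    (lam : Subgroup.center G →* ℂˣ) (hl : ∀ c : Subgroup.center G, ρ c = (lam c : ℂ) • 1)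
    (hne : lam ≠ 1) : ρ.character = chiOf p lam := by
  classical
  have hker : ∀ c, lam c = 1 → c = 1 := by
    have : Fact (Nat.card (Subgroup.center G)).Prime := ⟨by rwa [hZ]⟩
    rcases (lam.ker).eq_bot_or_eq_top_of_prime_card with hb | hb
    · intro c hc
      have : c ∈ lam.ker := hc
      rwa [hb, Subgroup.mem_bot] at this
    · exact absurd (MonoidHom.ker_eq_top_iff.1 hb) hne
  have hzero : ∀ g, g ∉ Subgroup.center G → ρ.character g = 0 := by
    intro g hg
    rw [Subgroup.mem_center_iff] at hg
    push Not at hg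
    obtain ⟨x, hx⟩ := hg
    let c : Subgroup.center G := ⟨⁅x, g⁆, hcomm (Subgroup.commutator_mem_commutator (Subgroup.mem_top _) (Subgroup.mem_top _))⟩
    have hcne : c ≠ 1 := by
      intro h1
      have : ⁅x, g⁆ = 1 := congrArg Subtype.val h1
      exact hx (commutatorElement_eq_one_iff_mul_comm.1 this)
    have h1 := char_smul (hl c) g
    have h2 : (c : G) * g = x * g * x⁻¹ := by simp [c, commutatorElement_def]
    rw [h2, Representation.char_conj] at h1
    by_contra h0
    have h3 : (lam c : ℂ) = 1 := by
      have : (lam c : ℂ) * ρ.character g = 1 * ρ.character g := by rw [one_mul]; exact h1.symm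
      exact mul_right_cancel₀ h0 this
    exact hcne (hker c (Units.ext h3))
  have hd : finrank ℂ V = p := by
    have hn := norm_one h
    have hval : ∀ g, ρ.character g * ρ.character g⁻¹ =
        if g ∈ Subgroup.center G then (finrank ℂ V : ℂ) ^ 2 else 0 := by
      intro g
      split_ifs with hg
      · have h1 := char_smul (hl ⟨g, hg⟩) g⁻¹
        simp only [mul_inv_cancel, Representation.char_one] at h1
        have h2 := char_smul_one (hl ⟨g, hg⟩)
        simp only at h2
        rw [h2, mul_right_comm, ← h1, sq]
      · rw [hzero g hg, zero_mul]
    simp only [hval] at hn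
    rw [← Finset.sum_filter, Finset.sum_const, nsmul_eq_mul, hcard] at hn
    have hc : (Finset.univ.filter (fun g => g ∈ Subgroup.center G)).card = p := by
      rw [← hZ, Nat.card_eq_fintype_card, Fintype.card_subtype]
    rw [hc] at hn
    have h3 : p * finrank ℂ V ^ 2 = p * p ^ 2 := by
      have : p * finrank ℂ V ^ 2 = p ^ 3 := by exact_mod_cast hn
      rw [this]; ring
    have h4 := Nat.eq_of_mul_eq_mul_left hp.pos h3
    exact Nat.pow_left_injective (n := 2) (by norm_num) h4
  funext g
  unfold chiOf
  split_ifs with hg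
  · have h2 := char_smul_one (hl ⟨g, hg⟩)
    rw [← hd]; exact h2
  · exact hzero g hg

theorem count_p3 {p : ℕ} (hp : p.Prime) {G : Type} [Group G] [Fintype G]
    (hcard : Nat.card G = p ^ 3) (hZ : Nat.card (Subgroup.center G) = p)
    (hcomm : commutator G ≤ Subgroup.center G) :
    Nat.card {χ : G → ℂ // IsIrredCharacter χ ∧ χ 1 ≠ 1} = p - 1 := by
  classical
  have hex : ∀ lam : Subgroup.center G →* ℂˣ, lam ≠ 1 →
      IsIrredCharacter (chiOf p lam) ∧ chiOf p lam 1 ≠ 1 := by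
    intro lam hlam
    constructor
    · obtain ⟨V, _, _, _, ρ, h1, h2⟩ := exists_irred' ((Units.coeHom ℂ).comp lam)
      rw [isIrred_iff]
      exact ⟨V, _, _, inferInstance, ρ, h1, char_eq_chiOf hp hcard hZ hcomm h1 lam h2 hlam⟩
    · have : chiOf p lam 1 = p := by
        unfold chiOf
        rw [dif_pos (one_mem _)]
        have : (⟨1, one_mem _⟩ : Subgroup.center G) = 1 := rfl
        simp [this]
      rw [this]
      exact_mod_cast hp.one_lt.ne'
  let F : {lam : Subgroup.center G →* ℂˣ // lam ≠ 1} →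
      {χ : G → ℂ // IsIrredCharacter χ ∧ χ 1 ≠ 1} := fun l => ⟨chiOf p l.1, hex l.1 l.2⟩
  have hF : Function.Bijective F := by
    constructor
    · rintro ⟨l, hl⟩ ⟨m, hm⟩ hlm
      apply Subtype.ext
      have h1 : chiOf p l = chiOf p m := congrArg Subtype.val hlm
      ext c
      have h2 := congrFun h1 c
      unfold chiOf at h2
      rw [dif_pos c.2, dif_pos c.2] at h2
      exact mul_right_cancel₀ (by exact_mod_cast hp.ne_zero) h2
    · rintro ⟨χ, h1, h2⟩
      obtain ⟨V, _, _, _, ρ, h3, rfl⟩ := (isIrred_iff χ).1 h1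
      obtain ⟨lam, hl⟩ := central_char h3
      have hlam : lam ≠ 1 := by
        rintro rfl
        apply h2
        rw [Representation.char_one, linear_of_comm h3]
        · simp
        · intro x y
          have h4 := hl ⟨⁅x, y⁆, hcomm (Subgroup.commutator_mem_commutator (Subgroup.mem_top _) (Subgroup.mem_top _))⟩
          have h5 : x * y = ⁅x, y⁆ * (y * x) := by simp [commutatorElement_def, mul_assoc]
          rw [h5, map_mul]
          simp only [MonoidHom.one_apply, Units.val_one, one_smul] at h4
          rw [h4, one_mul]
      exact ⟨⟨lam, hlam⟩, Subtype.ext (char_eq_chiOf hp hcard hZ hcomm h3 lam hl hlam).symm⟩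
  rw [← Nat.card_congr (Equiv.ofBijective F hF)]
  have hc : Nat.card (Subgroup.center G →* ℂˣ) = p := by
    exact (CommGroup.card_monoidHom_of_hasEnoughRootsOfUnity (Subgroup.center G) ℂ).trans hZ
  have : Finite (Subgroup.center G →* ℂˣ) := Nat.finite_of_card_ne_zero (by rw [hc]; exact hp.ne_zero)
  have := Fintype.ofFinite (Subgroup.center G →* ℂˣ)
  rw [Nat.card_eq_fintype_card] at hc ⊢
  rw [Fintype.card_subtype_compl, hc]
  simp

theorem p3_structure {p : ℕ} (hp : p.Prime) {H : Type} [Group H] [Fintype H]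
    (hcard : Nat.card H = p ^ 3) (hnc : ¬ IsMulCommutative H) :
    Nat.card (Subgroup.center H) = p ∧ commutator H ≤ Subgroup.center H := by
  have : Fact p.Prime := ⟨hp⟩
  obtain ⟨k, hk0, hk⟩ := IsPGroup.card_center_eq_prime_pow hcard (by norm_num)
  have hmul := (Subgroup.center H).card_mul_index
  rw [hk, hcard] at hmul
  have hk3 : k ≤ 3 := (Nat.pow_dvd_pow_iff_le_right hp.one_lt).1 ⟨_, hmul.symm⟩
  have hidx : Nat.card (H ⧸ Subgroup.center H) = p ^ (3 - k) := by
    have h1 : p ^ k * (Subgroup.center H).index = p ^ k * p ^ (3 - k) := by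
      rw [hmul, ← pow_add]; congr 1; omega
    exact Nat.eq_of_mul_eq_mul_left (pow_pos hp.pos k) h1
  have hk1 : k = 1 := by
    by_contra hne
    apply hnc
    have : IsCyclic (H ⧸ Subgroup.center H) := by
      apply isCyclic_of_card_dvd_prime (p := p)
      rw [hidx]
      exact (pow_dvd_pow p (by omega : 3 - k ≤ 1)).trans (by simp)
    exact isMulCommutative_of_isCyclic_quotient_center_self H
  subst hk1
  refine ⟨by simpa using hk, ?_⟩
  rw [← Subgroup.Normal.quotient_commutative_iff_commutator_le]
  exact IsPGroup.isMulCommutative_of_card_eq_prime_sq (p := p) hidx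

theorem card_ker_eq {p : ℕ} (hp : p.Prime) {Z : Type} [Group Z] [Finite Z]
    (hZcard : Nat.card Z = p ^ 2) (hZexp : ∀ z : Z, z ^ p = 1) (lam : Z →* ℂˣ) (hne : lam ≠ 1) :
    Nat.card lam.ker = p := by
  have hr : Nat.card lam.range ∣ p := by
    have : Finite lam.range := Finite.of_surjective _ lam.rangeRestrict_surjective
    have : IsCyclic lam.range := inferInstance
    rw [← IsCyclic.exponent_eq_card, Monoid.exponent_dvd_iff_forall_pow_eq_one]
    rintro ⟨_, z, rfl⟩
    apply Subtype.ext
    simp [← map_pow, hZexp]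
  have hm := lam.ker.card_mul_index
  rw [Subgroup.index_ker, hZcard] at hm
  rcases (Nat.dvd_prime hp).1 hr with h | h
  · exfalso
    apply hne
    have := Subgroup.card_eq_one.1 h
    exact MonoidHom.range_eq_bot_iff.1 this
  · rw [h, sq] at hm
    exact Nat.eq_of_mul_eq_mul_right hp.pos hm

theorem part_two {p : ℕ} (hp : p.Prime) {G : Type} [Group G] [Fintype G]
    (hZcard : Nat.card (Subgroup.center G) = p ^ 2)
    (hZexp : ∀ z ∈ Subgroup.center G, z ^ p = 1)
    (χ : G → ℂ) (hχ : IsIrredCharacter χ) (h1 : χ 1 ≠ 1)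
    (hz : ∃ z ∈ Subgroup.center G, χ z ≠ χ 1) :
      ∃ (K : Subgroup G) (hn : K.Normal),
        (K : Set G) = {g | χ g = χ 1} ∩ (Subgroup.center G : Set G) ∧
        Nat.card K = p ∧
        (haveI := hn;
         ∃ χbar : G ⧸ K → ℂ, IsIrredCharacter χbar ∧ χbar 1 ≠ 1 ∧
           (∃ z ∈ (Subgroup.center G).map (QuotientGroup.mk' K), χbar z ≠ χbar 1) ∧
           χ = χbar ∘ (QuotientGroup.mk : G → G ⧸ K)) := by
  obtain ⟨V, _, _, _, ρ, h3, rfl⟩ := (isIrred_iff χ).1 hχ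
  obtain ⟨lam, hl⟩ := central_char h3
  have hd : (finrank ℂ V : ℂ) ≠ 0 := by exact_mod_cast dim_ne h3
  have hiff : ∀ c : Subgroup.center G, ρ.character c = ρ.character 1 ↔ lam c = 1 := by
    intro c
    rw [char_smul_one (hl c), Representation.char_one]
    constructor
    · intro h
      exact Units.ext (mul_right_cancel₀ hd (by simpa using h))
    · intro h
      simp [h]
  have hne : lam ≠ 1 := by
    rintro rfl
    obtain ⟨z, hz, hz2⟩ := hz
    exact hz2 ((hiff ⟨z, hz⟩).2 rfl)
  let K : Subgroup G := lam.ker.map (Subgroup.center G).subtype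
  have hKle : K ≤ Subgroup.center G := Subgroup.map_subtype_le _
  have hn : K.Normal := ⟨fun k hk g => by
    rw [Subgroup.mem_center_iff.1 (hKle hk) g, mul_inv_cancel_right]; exact hk⟩
  have hmem : ∀ g, g ∈ K ↔ ρ.character g = ρ.character 1 ∧ g ∈ Subgroup.center G := by
    intro g
    constructor
    · rintro ⟨c, hc, rfl⟩
      exact ⟨(hiff c).2 hc, c.2⟩
    · rintro ⟨h, hg⟩
      exact ⟨⟨g, hg⟩, (hiff ⟨g, hg⟩).1 h, rfl⟩
  have hKker : K ≤ MonoidHom.ker ρ := by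
    rintro _ ⟨c, hc, rfl⟩
    have hc' : lam c = 1 := hc
    have := hl c
    rw [hc', Units.val_one, one_smul] at this
    exact this
  obtain ⟨χb, hb1, hb2⟩ := irred_quot h3 K hKker
  have hv : ∀ g : G, χb (g : G ⧸ K) = ρ.character g := fun g => (congrFun hb2 g).symm
  have hv1 : χb 1 = ρ.character 1 := hv 1
  refine ⟨K, hn, ?_, ?_, χb, hb1, ?_, ?_, hb2⟩
  · ext g; exact hmem g
  · have : Nat.card K = Nat.card lam.ker :=
      (Nat.card_congr (lam.ker.equivMapOfInjective _ (Subgroup.subtype_injective _)).toEquiv).symm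
    rw [this]
    exact card_ker_eq hp hZcard (fun z => Subtype.ext (hZexp z z.2)) lam hne
  · rw [hv1]; exact h1
  · obtain ⟨z, hz, hz2⟩ := hz
    refine ⟨(z : G ⧸ K), ⟨z, hz, rfl⟩, ?_⟩
    rw [hv1, hv]; exact hz2

end

theorem stmt_19 {p : ℕ} (hp : p.Prime) (hodd : Odd p)
    {G : Type} [Group G] [Fintype G]
    (hcard : Nat.card G = p ^ 5)
    (hZcard : Nat.card (Subgroup.center G) = p ^ 2)
    (hZexp : ∀ z ∈ Subgroup.center G, z ^ p = 1)
    (hG'card : Nat.card (commutator G) = p ^ 3)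
    (hG'ab : ∀ a ∈ commutator G, ∀ b ∈ commutator G, a * b = b * a)
    (hG'exp : ∀ a ∈ commutator G, a ^ p = 1)
    (hlt : Subgroup.center G < commutator G) :
    Nat.card {χ : (G ⧸ Subgroup.center G) → ℂ // IsIrredCharacter χ ∧ χ 1 ≠ 1} = p - 1 ∧
    (∀ χ : G → ℂ, IsIrredCharacter χ → χ 1 ≠ 1 →
      (∃ z ∈ Subgroup.center G, χ z ≠ χ 1) →
      ∃ (K : Subgroup G) (hn : K.Normal),
        (K : Set G) = {g | χ g = χ 1} ∩ (Subgroup.center G : Set G) ∧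
        Nat.card K = p ∧
        (haveI := hn;
         ∃ χbar : G ⧸ K → ℂ, IsIrredCharacter χbar ∧ χbar 1 ≠ 1 ∧
           (∃ z ∈ (Subgroup.center G).map (QuotientGroup.mk' K), χbar z ≠ χbar 1) ∧
           χ = χbar ∘ (QuotientGroup.mk : G → G ⧸ K))) ∧
    Function.Bijective
      (fun x : {x : Subgroup G × (G → ℂ) //
          x.1 ≤ Subgroup.center G ∧ Nat.card x.1 = p ∧
          IsIrredCharacter x.2 ∧ x.2 1 ≠ 1 ∧
          (∃ z ∈ Subgroup.center G, x.2 z ≠ x.2 1) ∧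
          ∀ k ∈ x.1, x.2 k = x.2 1} =>
        (⟨x.1.2, x.2.2.2.1, x.2.2.2.2.1, x.2.2.2.2.2.1⟩ :
          {χ : G → ℂ // IsIrredCharacter χ ∧ χ 1 ≠ 1 ∧
            ∃ z ∈ Subgroup.center G, χ z ≠ χ 1})) := by
  refine ⟨?_, fun χ h1 h2 h3 => part_two hp hZcard hZexp χ h1 h2 h3, ?_, ?_⟩
  · classical
    have hc : Nat.card (G ⧸ Subgroup.center G) = p ^ 3 := by
      have h1 := (Subgroup.center G).card_eq_card_quotient_mul_card_subgroup
      rw [hcard, hZcard] at h1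
      exact Nat.eq_of_mul_eq_mul_right (pow_pos hp.pos 2) (h1.symm.trans (by ring))
    have := Fintype.ofFinite (G ⧸ Subgroup.center G)
    obtain ⟨h1, h2⟩ := p3_structure hp hc (fun h =>
      not_le_of_gt hlt (Subgroup.Normal.quotient_commutative_iff_commutator_le.1 h))
    exact count_p3 hp hc h1 h2
  · rintro ⟨⟨K, χ⟩, a1, a2, a3, a4, a5, a6⟩ ⟨⟨L, ψ⟩, b1, b2, b3, b4, b5, b6⟩ h
    have hχ : χ = ψ := congrArg Subtype.val h
    subst hχ
    obtain ⟨M, _, hM, hMc, -⟩ := part_two hp hZcard hZexp χ a3 a4 a5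
    have key : ∀ N : Subgroup G, N ≤ Subgroup.center G → Nat.card N = p →
        (∀ k ∈ N, χ k = χ 1) → N = M := by
      intro N h1 h2 h3
      apply Subgroup.eq_of_le_of_card_ge
      · intro k hk
        have : k ∈ (M : Set G) := by
          rw [hM]; exact ⟨h3 k hk, h1 hk⟩
        exact this
      · rw [hMc, h2]
    have : K = L := (key K a1 a2 a6).trans (key L b1 b2 b6).symm
    subst this
    rfl
  · rintro ⟨χ, h1, h2, h3⟩
    obtain ⟨M, _, hM, hMc, -⟩ := part_two hp hZcard hZexp χ h1 h2 h3
    have hm : ∀ k ∈ M, χ k = χ 1 ∧ k ∈ Subgroup.center G := by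
      intro k hk
      have : k ∈ (M : Set G) := hk
      rw [hM] at this
      exact this
    exact ⟨⟨(M, χ), fun k hk => (hm k hk).2, hMc, h1, h2, h3, fun k hk => (hm k hk).1⟩, rfl⟩
end
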